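/- arXiv:1612.01819 — 3 statements merged into one kernel-verified Lean document; each statement's English description precedes it below -/
import Mathlib

section
/- Let a ≥ b > 0 and let K(a,b) = {(x,y) ∈ ℝ² : x²/a² + y²/b² ≤ 1} be the closed elliptical region. If 0 < r ≤ b²/a, then the area (two-dimensional Lebesgue measure) of the set {x ∈ ℝ² : closedBall(x,r) ⊆ K(a,b)} equals πr² + πab − 4raE(ε), where ε = √(a²−b²)/a and E(ε) = ∫₀^{π/2} √(1−ε² sin²θ) dθ. -/
open Real MeasureTheory Set Metric

noncomputable section

/-- The Euclidean plane. -/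
abbrev E2 := EuclideanSpace ℝ (Fin 2)

/-- Closed elliptical region with semi-axes `a`, `b`. -/
def Kset (a b : ℝ) : Set E2 := {x | (x 0)^2 / a^2 + (x 1)^2 / b^2 ≤ 1}

/-- The ellipse with semi-axes `a`, `b`. -/
def Cset (a b : ℝ) : Set E2 := {x | (x 0)^2 / a^2 + (x 1)^2 / b^2 = 1}

/-- Incomplete elliptic integral of the second kind `E(φ, ε)`. -/
def Einc (ε φ : ℝ) : ℝ := ∫ θ in (0:ℝ)..φ, Real.sqrt (1 - ε^2 * Real.sin θ^2)

/-- Complete elliptic integral of the second kind `E(ε)`. -/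
def Ecomp (ε : ℝ) : ℝ := Einc ε (π/2)

/-- Eccentricity of the ellipse with semi-axes `a ≥ b`. -/
def ecc (a b : ℝ) : ℝ := Real.sqrt (a^2 - b^2) / a

/-- Length of the normal vector `(b cos t, a sin t)` of the ellipse at `(a cos t, b sin t)`; it is
also the speed of this parametrisation. -/
def normalLength (a b t : ℝ) : ℝ := √(b ^ 2 * cos t ^ 2 + a ^ 2 * sin t ^ 2)

/-- First coordinate of the inner parallel curve of the ellipse at distance `r`. -/
def innerX (a b r t : ℝ) : ℝ := a * cos t - r * b * (cos t / normalLength a b t)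

/-- Second coordinate of the inner parallel curve of the ellipse at distance `r`. -/
def innerY (a b r t : ℝ) : ℝ := b * sin t - r * a * (sin t / normalLength a b t)

/-- Centers of disks of radius `r` contained in the ellipse, in coordinates. -/
def innerSet (a b r : ℝ) : Set (ℝ × ℝ) :=
  {p | ∀ v : ℝ × ℝ, v.1 ^ 2 + v.2 ^ 2 ≤ r ^ 2 →
    (p.1 + v.1) ^ 2 / a ^ 2 + (p.2 + v.2) ^ 2 / b ^ 2 ≤ 1}

section

variable {a b r t : ℝ}

lemma sq_normalLength : normalLength a b t ^ 2 = b ^ 2 * cos t ^ 2 + a ^ 2 * sin t ^ 2 :=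
  Real.sq_sqrt (by positivity)

lemma le_normalLength (hb : 0 < b) (hab : b ≤ a) : b ≤ normalLength a b t := by
  apply Real.le_sqrt_of_sq_le
  nlinarith [sin_sq_add_cos_sq t, mul_nonneg (sub_nonneg.2 (pow_le_pow_left₀ hb.le hab 2))
    (sq_nonneg (sin t))]

lemma normalLength_pos (hb : 0 < b) (hab : b ≤ a) : 0 < normalLength a b t :=
  hb.trans_le (le_normalLength hb hab)

lemma hasDerivAt_normalLength (hb : 0 < b) (hab : b ≤ a) :
    HasDerivAt (normalLength a b)
      ((a ^ 2 - b ^ 2) * (sin t * cos t) / normalLength a b t) t := by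
  have hw := normalLength_pos (t := t) hb hab
  have h : HasDerivAt (fun t ↦ b ^ 2 * cos t ^ 2 + a ^ 2 * sin t ^ 2)
      (2 * ((a ^ 2 - b ^ 2) * (sin t * cos t))) t := by
    refine ((((hasDerivAt_cos t).pow 2).const_mul (b ^ 2)).add
      (((hasDerivAt_sin t).pow 2).const_mul (a ^ 2))).congr_deriv ?_
    push_cast
    ring
  refine (h.sqrt (by rw [← sq_normalLength]; positivity)).congr_deriv ?_
  change _ / (2 * normalLength a b t) = _
  field_simp

lemma hasDerivAt_sin_mul_cos : HasDerivAt (fun t ↦ sin t * cos t) (cos t ^ 2 - sin t ^ 2) t :=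
  ((hasDerivAt_sin t).mul (hasDerivAt_cos t)).congr_deriv (by ring)

lemma hasDerivAt_innerX (hb : 0 < b) (hab : b ≤ a) :
    HasDerivAt (innerX a b r)
      (-(sin t * (a - r * b * a ^ 2 / normalLength a b t ^ 3))) t := by
  have hw := normalLength_pos (t := t) hb hab
  refine (((hasDerivAt_cos t).const_mul a).sub
    (((hasDerivAt_cos t).div (hasDerivAt_normalLength hb hab) hw.ne').const_mul
      (r * b))).congr_deriv ?_
  have h1 := sq_normalLength (a := a) (b := b) (t := t)
  have h2 := sin_sq_add_cos_sq t
  field_simp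
  linear_combination (r * b * sin t) * h1 + (r * b * sin t * a ^ 2) * h2

lemma hasDerivAt_sin_mul_cos_div (hb : 0 < b) (hab : b ≤ a) :
    HasDerivAt (fun t ↦ sin t * cos t / normalLength a b t)
      ((b ^ 2 * cos t ^ 4 - a ^ 2 * sin t ^ 4) / normalLength a b t ^ 3) t := by
  have hw := normalLength_pos (t := t) hb hab
  refine (hasDerivAt_sin_mul_cos.div (hasDerivAt_normalLength hb hab) hw.ne').congr_deriv ?_
  have h1 := sq_normalLength (a := a) (b := b) (t := t)
  field_simp
  linear_combination (cos t ^ 2 - sin t ^ 2) * h1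

lemma hasDerivAt_sin_mul_cos_div_sq (hb : 0 < b) (hab : b ≤ a) :
    HasDerivAt (fun t ↦ sin t * cos t / normalLength a b t ^ 2)
      ((b ^ 2 * cos t ^ 2 - a ^ 2 * sin t ^ 2) / normalLength a b t ^ 4) t := by
  have hw := normalLength_pos (t := t) hb hab
  refine (hasDerivAt_sin_mul_cos.div ((hasDerivAt_normalLength hb hab).pow 2)
    (pow_pos hw 2).ne').congr_deriv ?_
  have h1 := sq_normalLength (a := a) (b := b) (t := t)
  have h2 := sin_sq_add_cos_sq t
  simp only [Pi.pow_apply]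
  push_cast
  field_simp
  linear_combination (cos t ^ 2 - sin t ^ 2) * h1 +
    (b ^ 2 * cos t ^ 2 - a ^ 2 * sin t ^ 2) * h2

lemma hasDerivAt_normalAngle (hb : 0 < b) (hab : b ≤ a) :
    HasDerivAt
      (fun t ↦ t + arctan ((a - b) * (sin t * cos t) / (b * cos t ^ 2 + a * sin t ^ 2)))
      (a * b / normalLength a b t ^ 2) t := by
  have ha := hb.trans_le hab
  have h2 := sin_sq_add_cos_sq t
  have hD : 0 < b * cos t ^ 2 + a * sin t ^ 2 := by
    nlinarith [mul_nonneg (sub_nonneg.2 hab) (sq_nonneg (sin t))]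
  have hD' : HasDerivAt (fun t ↦ b * cos t ^ 2 + a * sin t ^ 2)
      (2 * (a - b) * (sin t * cos t)) t := by
    refine ((((hasDerivAt_cos t).pow 2).const_mul b).add
      (((hasDerivAt_sin t).pow 2).const_mul a)).congr_deriv ?_
    push_cast
    ring
  refine ((hasDerivAt_id t).add (((hasDerivAt_sin_mul_cos.const_mul (a - b)).div hD'
    hD.ne').arctan)).congr_deriv ?_
  have hw := normalLength_pos (t := t) hb hab
  have h1 : normalLength a b t ^ 2 =
      (b * cos t ^ 2 + a * sin t ^ 2) ^ 2 + ((a - b) * (sin t * cos t)) ^ 2 := by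
    rw [sq_normalLength]
    linear_combination (-(b ^ 2 * cos t ^ 2 + a ^ 2 * sin t ^ 2)) * h2
  have h3 : 1 + ((a - b) * (sin t * cos t) / (b * cos t ^ 2 + a * sin t ^ 2)) ^ 2 =
      normalLength a b t ^ 2 / (b * cos t ^ 2 + a * sin t ^ 2) ^ 2 := by
    rw [h1]
    field_simp
  simp only [Pi.div_apply]
  rw [h3]
  field_simp
  rw [h1]
  have hs : sin t ^ 2 = 1 - cos t ^ 2 := by linarith
  have e1 : sin t ^ 4 = (1 - cos t ^ 2) ^ 2 := by rw [← hs]; ring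
  ring_nf
  simp only [e1, hs]
  ring

/-- A primitive of the area density of the inner parallel region plus twice the perimeter
density. -/
def areaPrimitive (a b r t : ℝ) : ℝ :=
  a * b * (t - sin t * cos t) + 2 * r * b ^ 2 * (sin t * cos t / normalLength a b t) +
    r ^ 2 * ((t + arctan ((a - b) * (sin t * cos t) / (b * cos t ^ 2 + a * sin t ^ 2))) -
      a * b * (sin t * cos t / normalLength a b t ^ 2))

lemma hasDerivAt_areaPrimitive (hb : 0 < b) (hab : b ≤ a) :
    HasDerivAt (areaPrimitive a b r)
      (sin t * (a - r * b * a ^ 2 / normalLength a b t ^ 3) * (2 * innerY a b r t) +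
        2 * r * normalLength a b t) t := by
  have hw := normalLength_pos (t := t) hb hab
  refine (((((hasDerivAt_id t).sub hasDerivAt_sin_mul_cos).const_mul (a * b)).add
    ((hasDerivAt_sin_mul_cos_div hb hab).const_mul (2 * r * b ^ 2))).add
    (((hasDerivAt_normalAngle hb hab).sub
      ((hasDerivAt_sin_mul_cos_div_sq hb hab).const_mul (a * b))).const_mul
        (r ^ 2))).congr_deriv ?_
  have h1 := sq_normalLength (a := a) (b := b) (t := t)
  have h2 := sin_sq_add_cos_sq t
  have e1 : 1 - (cos t ^ 2 - sin t ^ 2) = 2 * sin t ^ 2 := by linarith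
  have e2 : b ^ 2 * (b ^ 2 * cos t ^ 4 - a ^ 2 * sin t ^ 4) / normalLength a b t ^ 3 =
      normalLength a b t - a ^ 2 * sin t ^ 2 / normalLength a b t -
        a ^ 2 * b ^ 2 * sin t ^ 2 / normalLength a b t ^ 3 := by
    field_simp
    rw [h1]
    linear_combination (-a ^ 2 * b ^ 2 * sin t ^ 2) * h2
  have e3 : a * b / normalLength a b t ^ 2 -
      a * b * ((b ^ 2 * cos t ^ 2 - a ^ 2 * sin t ^ 2) / normalLength a b t ^ 4) =
      2 * a ^ 3 * b * sin t ^ 2 / normalLength a b t ^ 4 := by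
    field_simp
    linear_combination a * h1
  rw [e1, e3, mul_div_assoc' (2 * r * b ^ 2), mul_assoc (2 * r), mul_div_assoc (2 * r), e2, innerY]
  field_simp
  ring

lemma continuous_normalLength : Continuous (normalLength a b) := by
  unfold normalLength
  fun_prop

lemma integral_normalLength (hb : 0 < b) (hab : b ≤ a) :
    ∫ t in (0 : ℝ)..π, normalLength a b t = 2 * (a * Ecomp (ecc a b)) := by
  have ha := hb.trans_le hab
  have hE : a * Ecomp (ecc a b) = ∫ t in (0 : ℝ)..π / 2, normalLength a b (t + π / 2) := by
    rw [Ecomp, Einc, ← intervalIntegral.integral_const_mul]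
    congr 1
    ext t
    rw [normalLength, cos_add_pi_div_two, sin_add_pi_div_two, ecc, div_pow,
      Real.sq_sqrt (sub_nonneg.2 (pow_le_pow_left₀ hb.le hab 2))]
    nth_rw 1 [← Real.sqrt_sq ha.le]
    rw [← Real.sqrt_mul (sq_nonneg a)]
    congr 1
    field_simp
    linear_combination (-a ^ 2) * sin_sq_add_cos_sq t
  have hE' : a * Ecomp (ecc a b) = ∫ t in (0 : ℝ)..π / 2, normalLength a b t := by
    have h := intervalIntegral.integral_comp_sub_left (normalLength a b) (a := 0) (b := π / 2)
      (π / 2)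
    rw [sub_self, sub_zero] at h
    rw [hE, ← h]
    congr 1
    ext t
    rw [normalLength, normalLength, cos_add_pi_div_two, sin_add_pi_div_two, cos_pi_div_two_sub,
      sin_pi_div_two_sub, neg_sq]
  rw [intervalIntegral.integral_comp_add_right, zero_add, add_halves] at hE
  rw [← intervalIntegral.integral_add_adjacent_intervals
    (continuous_normalLength.intervalIntegrable 0 (π / 2))
    (continuous_normalLength.intervalIntegrable (π / 2) π), ← hE, ← hE']
  ring

lemma continuous_innerY (hb : 0 < b) (hab : b ≤ a) : Continuous (innerY a b r) := by
  unfold innerY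
  have := continuous_normalLength (a := a) (b := b)
  have h0 : ∀ t, normalLength a b t ≠ 0 := fun t ↦ (normalLength_pos hb hab).ne'
  fun_prop (disch := exact h0 _)

lemma continuous_areaDensity (hb : 0 < b) (hab : b ≤ a) :
    Continuous fun t ↦
      sin t * (a - r * b * a ^ 2 / normalLength a b t ^ 3) * (2 * innerY a b r t) := by
  have := continuous_normalLength (a := a) (b := b)
  have := continuous_innerY (r := r) hb hab
  have h0 : ∀ t, normalLength a b t ^ 3 ≠ 0 := fun t ↦ (pow_pos (normalLength_pos hb hab) 3).ne'
  fun_prop (disch := exact h0 _)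

lemma integral_areaDensity (hb : 0 < b) (hab : b ≤ a) :
    ∫ t in (0 : ℝ)..π,
      sin t * (a - r * b * a ^ 2 / normalLength a b t ^ 3) * (2 * innerY a b r t) =
      π * r ^ 2 + π * a * b - 4 * r * a * Ecomp (ecc a b) := by
  have hc := continuous_areaDensity (r := r) hb hab
  have hc' : Continuous fun t ↦ 2 * r * normalLength a b t :=
    continuous_const.mul continuous_normalLength
  have h := intervalIntegral.integral_eq_sub_of_hasDerivAt (a := 0) (b := π)
    (fun t _ ↦ hasDerivAt_areaPrimitive (r := r) (t := t) hb hab)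
    ((hc.add hc').intervalIntegrable _ _)
  rw [intervalIntegral.integral_add (hc.intervalIntegrable _ _) (hc'.intervalIntegrable _ _),
    intervalIntegral.integral_const_mul, integral_normalLength hb hab] at h
  simp only [areaPrimitive, sin_pi, sin_zero, zero_mul, mul_zero, zero_div, arctan_zero] at h
  linear_combination h

lemma innerX_speed_nonneg (hb : 0 < b) (hab : b ≤ a) (hr2 : r * a ≤ b ^ 2) :
    0 ≤ a - r * b * a ^ 2 / normalLength a b t ^ 3 := by
  have hw := normalLength_pos (t := t) hb hab
  have ha := hb.trans_le hab
  rw [sub_nonneg, div_le_iff₀ (by positivity)]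
  calc r * b * a ^ 2 = (r * a) * (a * b) := by ring
    _ ≤ b ^ 2 * (a * b) := by gcongr
    _ = a * b ^ 3 := by ring
    _ ≤ a * normalLength a b t ^ 3 := by gcongr; exact le_normalLength hb hab

lemma antitoneOn_innerX (hb : 0 < b) (hab : b ≤ a) (hr2 : r * a ≤ b ^ 2) :
    AntitoneOn (innerX a b r) (Icc 0 π) := by
  have hd := fun t ↦ hasDerivAt_innerX (r := r) (t := t) hb hab
  refine antitoneOn_of_deriv_nonpos (convex_Icc 0 π)
    (fun t _ ↦ (hd t).continuousAt.continuousWithinAt)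
    (fun t _ ↦ (hd t).differentiableAt.differentiableWithinAt) fun t ht ↦ ?_
  rw [interior_Icc] at ht
  rw [(hd t).deriv, neg_nonpos]
  exact mul_nonneg (sin_pos_of_mem_Ioo ht).le (innerX_speed_nonneg hb hab hr2)

/-- The distance from a point of the inner parallel curve to the ellipse is at least `r`. -/
lemma sq_le_sq_dist_inner (hb : 0 < b) (hab : b ≤ a) (hr2 : r * a ≤ b ^ 2)
    {C S : ℝ} (h : C ^ 2 + S ^ 2 = 1) :
    r ^ 2 ≤ (a * C - innerX a b r t) ^ 2 + (b * S - innerY a b r t) ^ 2 := by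
  have hw := normalLength_pos (t := t) hb hab
  have hbw := le_normalLength (t := t) hb hab
  have h1 := sq_normalLength (a := a) (b := b) (t := t)
  have h2 := sin_sq_add_cos_sq t
  have hk : 0 ≤ 1 - (C * cos t + S * sin t) := by
    nlinarith [sq_nonneg (C - cos t), sq_nonneg (S - sin t)]
  have hr3 : r * (a * b / normalLength a b t) ≤ b ^ 2 := by
    rw [mul_div_assoc', div_le_iff₀ hw]
    nlinarith [mul_le_mul hr2 hbw hb.le (sq_nonneg b)]
  have hab2 := mul_nonneg (sub_nonneg.2 (pow_le_pow_left₀ hb.le hab 2)) (sq_nonneg (C - cos t))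
  have key : (a * C - innerX a b r t) ^ 2 + (b * S - innerY a b r t) ^ 2 =
      a ^ 2 * (C - cos t) ^ 2 + b ^ 2 * (S - sin t) ^ 2 -
        2 * (r * (a * b / normalLength a b t)) * (1 - (C * cos t + S * sin t)) + r ^ 2 := by
    rw [innerX, innerY]
    field_simp
    linear_combination (-r ^ 2) * h1 - (2 * r * a * b * normalLength a b t) * h2
  rw [key]
  nlinarith [mul_nonneg (sub_nonneg.2 hr3) hk]

lemma inner_mem_ellipse (hb : 0 < b) (hab : b ≤ a) (hr : 0 < r) (hr2 : r * a ≤ b ^ 2) :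
    innerX a b r t ^ 2 / a ^ 2 + innerY a b r t ^ 2 / b ^ 2 ≤ 1 := by
  have hw := normalLength_pos (t := t) hb hab
  have hbw := le_normalLength (t := t) hb hab
  have ha := hb.trans_le hab
  have hx : innerX a b r t ^ 2 / a ^ 2 =
      cos t ^ 2 * (1 - r * b / (a * normalLength a b t)) ^ 2 := by
    rw [innerX]
    field_simp
  have hy : innerY a b r t ^ 2 / b ^ 2 =
      sin t ^ 2 * (1 - r * a / (b * normalLength a b t)) ^ 2 := by
    rw [innerY]
    field_simp
  have h1 : r * b / (a * normalLength a b t) ≤ 1 := by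
    rw [div_le_one (by positivity)]
    nlinarith [mul_le_mul hab hbw hb.le ha.le]
  have h2 : r * a / (b * normalLength a b t) ≤ 1 := by
    rw [div_le_one (by positivity)]
    nlinarith
  have h1' : 0 ≤ r * b / (a * normalLength a b t) := by positivity
  have h2' : 0 ≤ r * a / (b * normalLength a b t) := by positivity
  rw [hx, hy]
  refine le_of_le_of_eq (add_le_add (mul_le_of_le_one_right (sq_nonneg _) ?_)
    (mul_le_of_le_one_right (sq_nonneg _) ?_)) (cos_sq_add_sin_sq t) <;>
  exact pow_le_one₀ (by linarith) (by linarith)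

lemma inner_mem_innerSet (hb : 0 < b) (hab : b ≤ a) (hr : 0 < r) (hr2 : r * a ≤ b ^ 2) :
    (innerX a b r t, innerY a b r t) ∈ innerSet a b r := by
  rintro ⟨v, w⟩ hv
  by_contra! hlt
  dsimp only at hv hlt
  have ha := hb.trans_le hab
  let q : ℝ → ℝ := fun l ↦
    (innerX a b r t + l * v) ^ 2 / a ^ 2 + (innerY a b r t + l * w) ^ 2 / b ^ 2
  have hq : Continuous q := by fun_prop
  have h0 : q 0 ≤ 1 := by
    simpa only [q, zero_mul, add_zero] using inner_mem_ellipse hb hab hr hr2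
  have h1 : 1 < q 1 := by simpa only [q, one_mul] using hlt
  obtain ⟨l, ⟨hl0, hl1⟩, hl⟩ := intermediate_value_Icc zero_le_one hq.continuousOn ⟨h0, h1.le⟩
  have hl1' : l < 1 := hl1.lt_of_ne (by rintro rfl; linarith)
  have hC : ((innerX a b r t + l * v) / a) ^ 2 + ((innerY a b r t + l * w) / b) ^ 2 = 1 := by
    rw [div_pow, div_pow]
    exact hl
  have h := sq_le_sq_dist_inner (t := t) hb hab hr2 hC
  rw [mul_div_cancel₀ _ ha.ne', mul_div_cancel₀ _ hb.ne', add_sub_cancel_left,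
    add_sub_cancel_left] at h
  have hl2 : l ^ 2 < 1 := by nlinarith
  nlinarith [mul_le_mul_of_nonneg_left hv (sq_nonneg l), mul_pos (sub_pos.2 hl2) (pow_pos hr 2)]

lemma neg_mem_innerSet {x y : ℝ} (h : (x, y) ∈ innerSet a b r) : (x, -y) ∈ innerSet a b r := by
  rintro ⟨v, w⟩ hv
  have := h (v, -w) (by simpa using hv)
  dsimp only at this ⊢
  rwa [← neg_sq (y + -w), neg_add, neg_neg] at this

lemma mem_innerSet_of_abs_le {x y Y : ℝ} (h : (x, Y) ∈ innerSet a b r) (hy : |y| ≤ Y) :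
    (x, y) ∈ innerSet a b r := by
  intro v hv
  have h1 := h v hv
  have h2 := neg_mem_innerSet h v hv
  dsimp only at h1 h2 ⊢
  obtain ⟨hy1, hy2⟩ := abs_le.1 hy
  rcases le_total 0 (y + v.2) with h0 | h0
  · refine le_trans ?_ h1
    gcongr
  · refine le_trans ?_ h2
    rw [← neg_sq (y + v.2), ← neg_sq (-Y + v.2)]
    gcongr
    linarith

lemma le_innerY_of_mem {y : ℝ} (hb : 0 < b) (hab : b ≤ a) (ht : 0 ≤ sin t)
    (h : (innerX a b r t, y) ∈ innerSet a b r) : y ≤ innerY a b r t := by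
  have hw := normalLength_pos (t := t) hb hab
  have ha := hb.trans_le hab
  have hn : (r * b * (cos t / normalLength a b t)) ^ 2 +
      (r * a * (sin t / normalLength a b t)) ^ 2 ≤ r ^ 2 := by
    refine le_of_eq ?_
    field_simp
    linear_combination (-r ^ 2) * sq_normalLength (a := a) (b := b) (t := t)
  have h1 := h (_, _) hn
  dsimp only at h1
  rw [innerX, sub_add_cancel, mul_pow, mul_div_cancel_left₀ _ (by positivity)] at h1
  have h2 : (y + r * a * (sin t / normalLength a b t)) ^ 2 ≤ (b * sin t) ^ 2 := by
    rw [← le_sub_iff_add_le', div_le_iff₀ (by positivity)] at h1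
    rw [mul_pow]
    linear_combination h1 - b ^ 2 * sin_sq_add_cos_sq t
  have := abs_le.1 (abs_le_of_sq_le_sq h2 (by positivity))
  rw [innerY]
  linarith [this.2]

lemma innerSet_slice (hb : 0 < b) (hab : b ≤ a) (hr : 0 < r) (hr2 : r * a ≤ b ^ 2)
    (ht : 0 ≤ sin t) :
    Prod.mk (innerX a b r t) ⁻¹' innerSet a b r = Icc (-innerY a b r t) (innerY a b r t) := by
  ext y
  rw [mem_preimage, mem_Icc, ← abs_le]
  refine ⟨fun h ↦ abs_le'.2 ⟨le_innerY_of_mem hb hab ht h,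
    le_innerY_of_mem hb hab ht (neg_mem_innerSet h)⟩,
    mem_innerSet_of_abs_le (inner_mem_innerSet hb hab hr hr2)⟩

lemma abs_le_of_mem_innerSet {x y : ℝ} (ha : 0 < a) (h : (x, y) ∈ innerSet a b r) :
    |x| ≤ a - r := by
  have hx : ∀ v, v ^ 2 = r ^ 2 → |x + v| ≤ a := fun v hv ↦ by
    have h1 := h (v, 0) (by simp [hv])
    dsimp only at h1
    have h2 : (x + v) ^ 2 / a ^ 2 ≤ 1 := le_trans (le_add_of_nonneg_right (by positivity)) h1
    rw [div_le_one (by positivity)] at h2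
    exact abs_le_of_sq_le_sq h2 ha.le
  have h1 := abs_le.1 (hx r rfl)
  have h2 := abs_le.1 (hx (-r) (neg_sq r))
  exact abs_le.2 ⟨by linarith [h2.1], by linarith [h1.2]⟩

lemma mem_image_innerX {x y : ℝ} (hb : 0 < b) (hab : b ≤ a)
    (h : (x, y) ∈ innerSet a b r) : x ∈ innerX a b r '' Icc 0 π := by
  have hx := abs_le.1 (abs_le_of_mem_innerSet (hb.trans_le hab) h)
  refine intermediate_value_Icc' pi_pos.le
    (fun t _ ↦ (hasDerivAt_innerX hb hab).continuousAt.continuousWithinAt) ⟨?_, ?_⟩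
  · simp only [innerX, normalLength, cos_pi, sin_pi]
    norm_num [Real.sqrt_sq hb.le]
    field_simp
    linarith [hx.1]
  · simp only [innerX, normalLength, cos_zero, sin_zero]
    norm_num [Real.sqrt_sq hb.le]
    field_simp
    linarith [hx.2]

lemma isClosed_innerSet : IsClosed (innerSet a b r) := by
  simp only [innerSet, ofPred_forall]
  refine isClosed_iInter fun v ↦ isClosed_iInter fun _ ↦ isClosed_le ?_ continuous_const
  fun_prop

lemma innerY_nonneg (hb : 0 < b) (hab : b ≤ a) (hr2 : r * a ≤ b ^ 2) (ht : 0 ≤ sin t) :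
    0 ≤ innerY a b r t := by
  have hw := normalLength_pos (t := t) hb hab
  have h : r * a / normalLength a b t ≤ b := by
    rw [div_le_iff₀ hw]
    nlinarith [le_normalLength (t := t) hb hab]
  calc 0 ≤ (b - r * a / normalLength a b t) * sin t := mul_nonneg (sub_nonneg.2 h) ht
    _ = innerY a b r t := by rw [innerY]; ring

lemma volume_innerSet (hb : 0 < b) (hab : b ≤ a) (hr : 0 < r) (hr2 : r * a ≤ b ^ 2) :
    volume (innerSet a b r) =
      ENNReal.ofReal (π * r ^ 2 + π * a * b - 4 * r * a * Ecomp (ecc a b)) := by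
  have hsin : ∀ t ∈ Icc 0 π, 0 ≤ sin t := fun t ht ↦ sin_nonneg_of_mem_Icc ht
  have hsupp : ∀ x, x ∉ innerX a b r '' Icc 0 π →
      volume (Prod.mk x ⁻¹' innerSet a b r) = 0 := fun x hx ↦ by
    rw [show Prod.mk x ⁻¹' innerSet a b r = ∅ from
      eq_empty_of_forall_notMem fun y hy ↦ hx (mem_image_innerX hb hab hy), measure_empty]
  have hslice : ∀ t ∈ Icc 0 π,
      volume (Prod.mk (innerX a b r t) ⁻¹' innerSet a b r) =
        ENNReal.ofReal (2 * innerY a b r t) := fun t ht ↦ by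
    rw [innerSet_slice hb hab hr hr2 (hsin t ht), Real.volume_Icc]
    congr 1
    ring
  rw [Measure.volume_eq_prod, Measure.prod_apply isClosed_innerSet.measurableSet,
    ← setLIntegral_eq_of_support_subset fun x ↦ not_imp_comm.1 (hsupp x),
    lintegral_image_eq_lintegral_deriv_mul_of_antitoneOn measurableSet_Icc
      (fun t _ ↦ (hasDerivAt_innerX hb hab).hasDerivWithinAt) (antitoneOn_innerX hb hab hr2),
    ← integral_areaDensity hb hab, intervalIntegral.integral_of_le pi_pos.le,
    ← integral_Icc_eq_integral_Ioc, ofReal_integral_eq_lintegral_ofReal]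
  · refine setLIntegral_congr_fun measurableSet_Icc fun t ht ↦ ?_
    rw [hslice t ht, neg_neg, ← ENNReal.ofReal_mul
      (mul_nonneg (hsin t ht) (innerX_speed_nonneg hb hab hr2))]
  · exact (continuous_areaDensity hb hab).continuousOn.integrableOn_compact isCompact_Icc
  · refine (ae_restrict_iff' measurableSet_Icc).2 (ae_of_all _ fun t ht ↦ ?_)
    exact mul_nonneg (mul_nonneg (hsin t ht) (innerX_speed_nonneg hb hab hr2))
      (mul_nonneg zero_le_two (innerY_nonneg hb hab hr2 (hsin t ht)))

lemma setOf_closedBall_subset_eq_preimage (hr : 0 ≤ r) :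
    {x : E2 | closedBall x r ⊆ Kset a b} =
      (fun x : E2 ↦ (x 0, x 1)) ⁻¹' innerSet a b r := by
  ext x
  simp only [mem_ofPred_eq, mem_preimage, innerSet]
  constructor
  · rintro h ⟨v, w⟩ hv
    have := @h (x + !₂[v, w]) (by
      rw [mem_closedBall, dist_self_add_left, EuclideanSpace.norm_eq]
      exact Real.sqrt_le_iff.2 ⟨hr, by simpa [Fin.sum_univ_two] using hv⟩)
    simpa [Kset] using this
  · intro h y hy
    have := h (y 0 - x 0, y 1 - x 1) (by
      rw [mem_closedBall, EuclideanSpace.dist_eq, Real.sqrt_le_iff] at hy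
      simpa [Fin.sum_univ_two, Real.dist_eq, sq_abs] using hy.2)
    simpa [Kset] using this

lemma measurePreserving_coords :
    MeasurePreserving (fun x : E2 ↦ (x 0, x 1)) volume volume :=
  (volume_preserving_finTwoArrow ℝ).comp (PiLp.volume_preserving_ofLp (Fin 2))

end

/-- Case 1 of Lemma 1: for `0 < r ≤ b²/a`, the area of the set of centers `x` with
`closedBall x r ⊆ K(a,b)` is `πr² + πab − 4raE(ε)`. -/
theorem area_ball_subset_ellipse_case1 (a b r : ℝ) (hb : 0 < b) (hab : b ≤ a)
    (hr : 0 < r) (hr2 : r ≤ b^2 / a) :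
    volume {x : E2 | closedBall x r ⊆ Kset a b} =
      ENNReal.ofReal (π * r^2 + π * a * b - 4 * r * a * Ecomp (ecc a b)) := by
  rw [setOf_closedBall_subset_eq_preimage hr.le,
    measurePreserving_coords.measure_preimage isClosed_innerSet.measurableSet.nullMeasurableSet,
    volume_innerSet hb hab hr ((le_div_iff₀ (hb.trans_le hab)).1 hr2)]
end
end

section
/- Let a ≥ b > 0, C(a,b) = {(x,y) ∈ ℝ² : x²/a² + y²/b² = 1}, and 0 < r ≤ b²/a. Then the area of the set {x ∈ ℝ² : the circle sphere(x,r) meets C(a,b) in exactly 2 points, i.e. (sphere(x,r) ∩ C(a,b)) has cardinality 2} equals 8raE(ε), where ε = √(a²−b²)/a and E(ε) = ∫₀^{π/2} √(1−ε² sin²θ) dθ. -/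
open Real MeasureTheory Set Metric

noncomputable section

/-- A quadratic form `P w² - 2 Q w + R` with nonnegative diagonal coefficients and nonpositive
discriminant is nonnegative. -/
lemma two_mul_mul_le_of_sq_le {P Q R w : ℝ} (hP : 0 ≤ P) (hR : 0 ≤ R) (h : Q ^ 2 ≤ P * R) :
    2 * (Q * w) ≤ P * w ^ 2 + R := by
  apply le_of_abs_le
  apply abs_le_of_sq_le_sq _ (by positivity)
  nlinarith [sq_nonneg (P * w ^ 2 - R), mul_le_mul_of_nonneg_right h (sq_nonneg w)]

/-- The polynomial inequality behind the discriminant bound for the ellipse. -/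
lemma sq_sq_mul_le_of_le {A B E : ℝ} (hA : 0 ≤ A) (hAE : A ≤ E) (hEB : E ≤ B) :
    0 ≤ B ^ 3 - A * B * E - E * ((E - A) * (B - E)) ∧
    E ^ 4 * ((E - A) * (B - E)) ≤
      (B ^ 3 - E ^ 3) * (B ^ 3 - A * B * E - E * ((E - A) * (B - E))) := by
  obtain ⟨u, rfl⟩ : ∃ u, E = A + u := ⟨E - A, by ring⟩
  obtain ⟨v, rfl⟩ : ∃ v, B = A + u + v := ⟨B - (A + u), by ring⟩
  have hu : 0 ≤ u := by linarith
  have hv : 0 ≤ v := by linarith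
  constructor
  · have : (A + u + v) ^ 3 - A * (A + u + v) * (A + u)
        - (A + u) * ((A + u - A) * (A + u + v - (A + u)))
      = (A + u + v) * v * (2 * A + 2 * u + v) + (A + u) ^ 2 * u := by ring
    rw [this]
    positivity
  · rw [← sub_nonneg]
    ring_nf
    positivity

/-- Two distinct points `p`, `q` on the ellipse `α x² + β y² = 1` lying on a common circle of
radius `r`, where `r² β² ≤ α`, have oppositely oriented intersections. -/
lemma cross_mul_cross_nonpos {α β r p₀ p₁ q₀ q₁ u₀ u₁ v₀ v₁ : ℝ} (hα : 0 < α) (hαβ : α ≤ β)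
    (hr : r ^ 2 * β ^ 2 ≤ α)
    (hp : α * p₀ ^ 2 + β * p₁ ^ 2 = 1) (hq : α * q₀ ^ 2 + β * q₁ ^ 2 = 1)
    (hu : u₀ ^ 2 + u₁ ^ 2 = r ^ 2) (hv : v₀ ^ 2 + v₁ ^ 2 = r ^ 2)
    (h₀ : u₀ - v₀ = p₀ - q₀) (h₁ : u₁ - v₁ = p₁ - q₁) (hne : p₀ ≠ q₀ ∨ p₁ ≠ q₁) :
    (α * p₀ * u₁ - β * p₁ * u₀) * (α * q₀ * v₁ - β * q₁ * v₀) ≤ 0 := by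
  have hβ : 0 < β := hα.trans_le hαβ
  obtain ⟨k₀, hk₀⟩ : ∃ k₀, k₀ = (p₀ - q₀) / 2 := ⟨_, rfl⟩
  obtain ⟨k₁, hk₁⟩ : ∃ k₁, k₁ = (p₁ - q₁) / 2 := ⟨_, rfl⟩
  obtain ⟨m₀, hm₀⟩ : ∃ m₀, m₀ = (p₀ + q₀) / 2 := ⟨_, rfl⟩
  obtain ⟨m₁, hm₁⟩ : ∃ m₁, m₁ = (p₁ + q₁) / 2 := ⟨_, rfl⟩
  obtain ⟨w₀, hw₀⟩ : ∃ w₀, w₀ = (u₀ + v₀) / 2 := ⟨_, rfl⟩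
  obtain ⟨w₁, hw₁⟩ : ∃ w₁, w₁ = (u₁ + v₁) / 2 := ⟨_, rfl⟩
  obtain rfl : p₀ = m₀ + k₀ := by linarith
  obtain rfl : p₁ = m₁ + k₁ := by linarith
  obtain rfl : q₀ = m₀ - k₀ := by linarith
  obtain rfl : q₁ = m₁ - k₁ := by linarith
  obtain rfl : u₀ = w₀ + k₀ := by linarith
  obtain rfl : u₁ = w₁ + k₁ := by linarith
  obtain rfl : v₀ = w₀ - k₀ := by linarith
  obtain rfl : v₁ = w₁ - k₁ := by linarith
  clear hk₀ hk₁ hm₀ hm₁ hw₀ hw₁ h₀ h₁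
  obtain ⟨K, hK⟩ : ∃ K, K = k₀ ^ 2 + k₁ ^ 2 := ⟨_, rfl⟩
  have hKpos : 0 < K := by
    rw [hK]
    rcases hne with h | h
    · have : k₀ ≠ 0 := by rintro rfl; simp at h
      positivity
    · have : k₁ ≠ 0 := by rintro rfl; simp at h
      positivity
  have hmk : α * m₀ * k₀ + β * m₁ * k₁ = 0 := by linarith
  have hwk : w₀ * k₀ + w₁ * k₁ = 0 := by linarith
  have hm : α * (m₀ ^ 2 + k₀ ^ 2) + β * (m₁ ^ 2 + k₁ ^ 2) = 1 := by linarith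
  have hw : w₀ ^ 2 + w₁ ^ 2 + K = r ^ 2 := by linarith
  obtain ⟨M, hM⟩ : ∃ M, M = (β * m₁ * k₀ - α * m₀ * k₁) / K := ⟨_, rfl⟩
  obtain ⟨W, hW⟩ : ∃ W, W = (w₁ * k₀ - w₀ * k₁) / K := ⟨_, rfl⟩
  rw [eq_div_iff hKpos.ne'] at hM hW
  have hM0 : α * m₀ = -M * k₁ := by
    apply mul_right_cancel₀ hKpos.ne'
    linear_combination k₁ * hM + k₀ * hmk + α * m₀ * hK
  have hM1 : β * m₁ = M * k₀ := by
    apply mul_right_cancel₀ hKpos.ne'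
    linear_combination -k₀ * hM + k₁ * hmk + β * m₁ * hK
  have hW0 : w₀ = -W * k₁ := by
    apply mul_right_cancel₀ hKpos.ne'
    linear_combination k₁ * hW + k₀ * hwk + w₀ * hK
  have hW1 : w₁ = W * k₀ := by
    apply mul_right_cancel₀ hKpos.ne'
    linear_combination -k₀ * hW + k₁ * hwk + w₁ * hK
  obtain ⟨E, hE⟩ : ∃ E, E = α * k₀ ^ 2 + β * k₁ ^ 2 := ⟨_, rfl⟩
  obtain ⟨S, hS⟩ : ∃ S, S = (α - β) * (k₀ * k₁) := ⟨_, rfl⟩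
  have hAE : α * K ≤ E := by
    rw [hE, hK]; nlinarith [mul_nonneg (sub_nonneg.2 hαβ) (sq_nonneg k₁)]
  have hEB : E ≤ β * K := by
    rw [hE, hK]; nlinarith [mul_nonneg (sub_nonneg.2 hαβ) (sq_nonneg k₀)]
  have hEpos : 0 < E := lt_of_lt_of_le (by positivity) hAE
  have hS2 : S ^ 2 = (E - α * K) * (β * K - E) := by
    rw [hS, hE, hK]; ring
  have hME : M ^ 2 * E + α * β * E = α * β := by
    have e1 : α * β * (α * m₀ ^ 2 + β * m₁ ^ 2) = M ^ 2 * E := by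
      have : α * β * (α * m₀ ^ 2 + β * m₁ ^ 2)
        = β * (α * m₀) ^ 2 + α * (β * m₁) ^ 2 := by ring
      rw [this, hM0, hM1, hE]; ring
    rw [← e1, hE]
    linear_combination α * β * hm
  have hWr : W ^ 2 * K + K = r ^ 2 := by
    rw [← hw, hW0, hW1, hK]; ring
  obtain ⟨hR, hdisc⟩ := sq_sq_mul_le_of_le (A := α * K) (B := β * K) (E := E)
    (by positivity) hAE hEB
  have hP : 0 ≤ (β * K) ^ 3 - E ^ 3 := by
    have := pow_le_pow_left₀ hEpos.le hEB 3
    linarith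
  have hquad := two_mul_mul_le_of_sq_le (Q := E ^ 2 * |S|) (w := |W|) hP hR (by
    rw [mul_pow, sq_abs, hS2]
    convert hdisc using 1
    ring)
  have key : (|W| * E + |S|) ^ 2 ≤ (M * K) ^ 2 := by
    refine le_of_mul_le_mul_left ?_ hEpos
    have h1 : (β * K) ^ 3 * (W ^ 2 + 1) ≤ α * β * K ^ 2 := by
      have : r ^ 2 * β ^ 2 * (β * K ^ 2) ≤ α * (β * K ^ 2) :=
        mul_le_mul_of_nonneg_right hr (by positivity)
      rw [← hWr] at this
      linarith
    have h2 : E * (M * K) ^ 2 = α * β * K ^ 2 - α * K * (β * K) * E := by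
      linear_combination K ^ 2 * hME
    have h3 : E * (|W| * E + |S|) ^ 2
        = E ^ 3 * W ^ 2 + 2 * (E ^ 2 * |S| * |W|) + E * ((E - α * K) * (β * K - E)) := by
      rw [← hS2, ← sq_abs W, ← sq_abs S]; ring
    rw [sq_abs] at hquad
    rw [h2, h3]
    linarith
  have hSD : S ^ 2 ≤ (M * K - W * E) ^ 2 := by
    rw [sq_le_sq]
    have h1 : |W| * E + |S| ≤ |M * K| := by
      have := sq_le_sq.1 key
      rwa [abs_of_nonneg (by positivity)] at this
    have h2 := abs_sub_abs_le_abs_sub (M * K) (W * E)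
    rw [abs_mul W E, abs_of_pos hEpos] at h2
    linarith
  have e1 : α * (m₀ + k₀) * (w₁ + k₁) - β * (m₁ + k₁) * (w₀ + k₀) = S - (M * K - W * E) := by
    have : α * (m₀ + k₀) * (w₁ + k₁) - β * (m₁ + k₁) * (w₀ + k₀)
      = (α * m₀ + α * k₀) * (w₁ + k₁) - (β * m₁ + β * k₁) * (w₀ + k₀) := by ring
    rw [this, hM0, hM1, hW0, hW1, hS, hK, hE]; ring
  have e2 : α * (m₀ - k₀) * (w₁ - k₁) - β * (m₁ - k₁) * (w₀ - k₀) = S + (M * K - W * E) := by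
    have : α * (m₀ - k₀) * (w₁ - k₁) - β * (m₁ - k₁) * (w₀ - k₀)
      = (α * m₀ - α * k₀) * (w₁ - k₁) - (β * m₁ - β * k₁) * (w₀ - k₀) := by ring
    rw [this, hM0, hM1, hW0, hW1, hS, hK, hE]; ring
  rw [e1, e2]
  linarith

lemma exists_angle_of_sq_add_sq {x y : ℝ} (h : x ^ 2 + y ^ 2 = 1) :
    ∃ θ ∈ Ioc (-π) π, cos θ = x ∧ sin θ = y := by
  have hn : ‖(⟨x, y⟩ : ℂ)‖ = 1 := by
    rw [Complex.norm_def, Complex.normSq_mk, ← sq, ← sq, h, sqrt_one]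
  refine ⟨Complex.arg ⟨x, y⟩, Complex.arg_mem_Ioc _, ?_, ?_⟩
  · simpa [hn] using Complex.norm_mul_cos_arg ⟨x, y⟩
  · simpa [hn] using Complex.norm_mul_sin_arg ⟨x, y⟩

lemma angle_eq_of_cos_eq_of_sin_eq {s t : ℝ} (hlt : |s - t| < 2 * π)
    (hc : cos s = cos t) (hsin : sin s = sin t) : s = t := by
  have h : cos (s - t) = 1 := by
    rw [cos_sub, hc, hsin, ← sq, ← sq, cos_sq_add_sin_sq]
  have := (cos_eq_one_iff_of_lt_of_lt (abs_lt.1 hlt).1 (abs_lt.1 hlt).2).1 h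
  linarith

lemma abs_sub_lt_two_pi {s t : ℝ} (hs : s ∈ Ioc (-π) π) (ht : t ∈ Ioc (-π) π) :
    |s - t| < 2 * π := by
  rw [abs_lt]
  constructor <;> linarith [hs.1, hs.2, ht.1, ht.2]

/-- The positive part of a sinusoid `A cos + B sin` has integral `2 √(A² + B²)` over a period. -/
lemma integral_max_cos_sin (A B : ℝ) :
    ∫ φ in (-π)..π, max (A * cos φ + B * sin φ) 0 = 2 * √(A ^ 2 + B ^ 2) := by
  have hcos : ∫ φ in (-π)..π, max (cos φ) 0 = 2 := by
    have hper : Function.Periodic (fun φ => max (cos φ) 0) (2 * π) := fun φ => by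
      simp only [cos_add_two_pi]
    have h := hper.intervalIntegral_add_eq (-π) (-(π / 2))
    rw [show -π + 2 * π = π by ring, show -(π / 2) + 2 * π = 3 * π / 2 by ring] at h
    have hc : Continuous fun φ : ℝ => max (cos φ) 0 := by fun_prop
    rw [h, ← intervalIntegral.integral_add_adjacent_intervals (b := π / 2)
      (hc.intervalIntegrable _ _) (hc.intervalIntegrable _ _)]
    have h1 : ∫ φ in (-(π / 2))..(π / 2), max (cos φ) 0 = ∫ φ in (-(π / 2))..(π / 2), cos φ := by
      apply intervalIntegral.integral_congr
      intro φ hφ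
      rw [uIcc_of_le (by linarith [pi_pos])] at hφ
      exact max_eq_left (cos_nonneg_of_mem_Icc hφ)
    have h2 : ∫ φ in (π / 2)..(3 * π / 2), max (cos φ) 0 = ∫ φ in (π / 2)..(3 * π / 2), 0 := by
      apply intervalIntegral.integral_congr
      intro φ hφ
      rw [uIcc_of_le (by linarith [pi_pos])] at hφ
      exact max_eq_right (cos_nonpos_of_pi_div_two_le_of_le hφ.1 (by linarith [hφ.2]))
    rw [h1, h2, integral_cos]
    simp
    norm_num
  set ρ := √(A ^ 2 + B ^ 2) with hρ
  have hρ2 : ρ ^ 2 = A ^ 2 + B ^ 2 := sq_sqrt (by positivity)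
  have hρ0 : 0 ≤ ρ := sqrt_nonneg _
  obtain ⟨ψ, hψA, hψB⟩ : ∃ ψ, ρ * cos ψ = A ∧ ρ * sin ψ = B := by
    refine ⟨Complex.arg ⟨A, B⟩, ?_, ?_⟩
    · rw [hρ]
      simpa [Complex.norm_def, Complex.normSq_mk, ← sq] using Complex.norm_mul_cos_arg ⟨A, B⟩
    · rw [hρ]
      simpa [Complex.norm_def, Complex.normSq_mk, ← sq] using Complex.norm_mul_sin_arg ⟨A, B⟩
  have hper : Function.Periodic (fun φ => max (cos φ) 0) (2 * π) := fun φ => by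
    simp only [cos_add_two_pi]
  calc ∫ φ in (-π)..π, max (A * cos φ + B * sin φ) 0
      = ∫ φ in (-π)..π, ρ * max (cos (φ - ψ)) 0 := by
        congr 1
        ext φ
        rw [mul_max_of_nonneg _ _ hρ0, mul_zero, cos_sub, ← hψA, ← hψB]
        ring_nf
    _ = ρ * ∫ φ in (-π - ψ)..(π - ψ), max (cos φ) 0 := by
        rw [intervalIntegral.integral_const_mul,
          intervalIntegral.integral_comp_sub_right (fun φ => max (cos φ) 0)]
    _ = 2 * ρ := by
        have h := hper.intervalIntegral_add_eq (-π - ψ) (-π)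
        rw [show -π - ψ + 2 * π = π - ψ by ring, show -π + 2 * π = π by ring] at h
        rw [h, hcos, mul_comm]

/-- The perimeter of the ellipse in terms of the complete elliptic integral. -/
lemma integral_sqrt_eq_Ecomp {a b : ℝ} (hb : 0 < b) (hab : b ≤ a) :
    ∫ θ in (-π)..π, √(a ^ 2 * cos θ ^ 2 + b ^ 2 * sin θ ^ 2) = 4 * (a * Ecomp (ecc a b)) := by
  have ha : 0 < a := hb.trans_le hab
  set f : ℝ → ℝ := fun θ => √(a ^ 2 * cos θ ^ 2 + b ^ 2 * sin θ ^ 2) with hf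
  have hfc : Continuous f := by fun_prop
  have hE : ∫ θ in (0 : ℝ)..(π / 2), f θ = a * Ecomp (ecc a b) := by
    rw [Ecomp, Einc, ← intervalIntegral.integral_const_mul]
    congr 1
    ext θ
    have h : a ^ 2 * cos θ ^ 2 + b ^ 2 * sin θ ^ 2
        = a ^ 2 * (1 - ecc a b ^ 2 * sin θ ^ 2) := by
      rw [ecc, div_pow, sq_sqrt (by nlinarith), cos_sq']
      field_simp
      ring
    simp only [hf]
    rw [h, sqrt_mul (sq_nonneg a), sqrt_sq ha.le]
  have hper : Function.Periodic f π := fun θ => by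
    simp only [hf, cos_add_pi, sin_add_pi, neg_sq]
  have h1 : ∫ θ in (-π)..(0 : ℝ), f θ = ∫ θ in (0 : ℝ)..π, f θ := by
    have := hper.intervalIntegral_add_eq (-π) 0
    simpa using this
  have h2 : ∫ θ in (π / 2)..π, f θ = ∫ θ in (0 : ℝ)..(π / 2), f θ := by
    have := intervalIntegral.integral_comp_sub_left (a := 0) (b := π / 2) f π
    rw [show π - π / 2 = π / 2 by ring, sub_zero] at this
    rw [← this]
    congr 1
    ext θ
    simp only [hf, cos_pi_sub, sin_pi_sub, neg_sq]
  rw [← intervalIntegral.integral_add_adjacent_intervals (b := 0)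
      (hfc.intervalIntegrable _ _) (hfc.intervalIntegrable _ _), h1,
    ← intervalIntegral.integral_add_adjacent_intervals (a := 0) (b := π / 2)
      (hfc.intervalIntegrable _ _) (hfc.intervalIntegrable _ _), h2, hE]
  ring

/-- The center of the circle of radius `r` that meets the ellipse at the point with parameter
`p.1`, this point being in direction `p.2` from the center. -/
def circleCenter (a b r : ℝ) (p : ℝ × ℝ) : ℝ × ℝ :=
  (a * sin p.1 - r * cos p.2, b * cos p.1 - r * sin p.2)

/-- The Jacobian determinant of `circleCenter`. -/
def circleCenterJacobian (a b r : ℝ) (p : ℝ × ℝ) : ℝ :=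
  r * (b * sin p.1 * sin p.2 - a * cos p.1 * cos p.2)

/-- The derivative of `circleCenter`. -/
def fderivCircleCenter (a b r : ℝ) (p : ℝ × ℝ) : ℝ × ℝ →L[ℝ] ℝ × ℝ :=
  (Matrix.toLin (.finTwoProd ℝ) (.finTwoProd ℝ)
    !![a * cos p.1, r * sin p.2; -(b * sin p.1), -(r * cos p.2)]).toContinuousLinearMap

lemma hasFDerivAt_circleCenter (a b r : ℝ) (p : ℝ × ℝ) :
    HasFDerivAt (circleCenter a b r) (fderivCircleCenter a b r p) p := by
  unfold fderivCircleCenter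
  rw [Matrix.toLin_finTwoProd_toContinuousLinearMap]
  convert!
    HasFDerivAt.prodMk (𝕜 := ℝ)
      ((((hasDerivAt_sin p.1).comp_hasFDerivAt p hasFDerivAt_fst).const_mul a).sub
        (((hasDerivAt_cos p.2).comp_hasFDerivAt p hasFDerivAt_snd).const_mul r))
      ((((hasDerivAt_cos p.1).comp_hasFDerivAt p hasFDerivAt_fst).const_mul b).sub
        (((hasDerivAt_sin p.2).comp_hasFDerivAt p hasFDerivAt_snd).const_mul r)) using 2 <;>
  simp [smul_smul, sub_eq_add_neg, neg_smul _ (ContinuousLinearMap.fst ℝ ℝ ℝ),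
    neg_smul _ (ContinuousLinearMap.snd ℝ ℝ ℝ)]

lemma det_fderivCircleCenter (a b r : ℝ) (p : ℝ × ℝ) :
    (fderivCircleCenter a b r p).det = circleCenterJacobian a b r p := by
  unfold fderivCircleCenter circleCenterJacobian
  simp only [LinearMap.det_toContinuousLinearMap, LinearMap.det_toLin, Matrix.det_fin_two_of]
  ring

lemma continuous_circleCenterJacobian (a b r : ℝ) : Continuous (circleCenterJacobian a b r) := by
  unfold circleCenterJacobian
  fun_prop

/-- The common points of the ellipse and the circle of radius `r` centered at `z`. -/
def commonPoints (a b r : ℝ) (z : ℝ × ℝ) : Set (ℝ × ℝ) :=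
  {p | p.1 ^ 2 / a ^ 2 + p.2 ^ 2 / b ^ 2 = 1 ∧ (p.1 - z.1) ^ 2 + (p.2 - z.2) ^ 2 = r ^ 2}

/-- The sign of this quantity is the orientation in which the circle centered at `z` crosses the
ellipse at `p`. -/
def crossing (a b : ℝ) (z p : ℝ × ℝ) : ℝ :=
  p.1 / a ^ 2 * (p.2 - z.2) - p.2 / b ^ 2 * (p.1 - z.1)

lemma mul_crossing_circleCenter {a b r : ℝ} (ha : a ≠ 0) (hb : b ≠ 0) (p : ℝ × ℝ) :
    a * b * crossing a b (circleCenter a b r p) (a * sin p.1, b * cos p.1) =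
      circleCenterJacobian a b r p := by
  unfold crossing circleCenter circleCenterJacobian
  field_simp
  ring

lemma mem_commonPoints_circleCenter {a b r : ℝ} (ha : a ≠ 0) (hb : b ≠ 0) (p : ℝ × ℝ) :
    (a * sin p.1, b * cos p.1) ∈ commonPoints a b r (circleCenter a b r p) := by
  refine ⟨?_, ?_⟩
  · simp only [mul_pow]
    rw [mul_div_cancel_left₀ _ (pow_ne_zero 2 ha), mul_div_cancel_left₀ _ (pow_ne_zero 2 hb),
      sin_sq_add_cos_sq]
  · simp only [circleCenter, sub_sub_cancel, mul_pow]
    rw [← mul_add, cos_sq_add_sin_sq, mul_one]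

lemma exists_circleCenter_eq {a b r : ℝ} (ha : a ≠ 0) (hb : b ≠ 0) (hr : r ≠ 0) {z q : ℝ × ℝ}
    (hq : q ∈ commonPoints a b r z) :
    ∃ p ∈ Ioc (-π) π ×ˢ Ioc (-π) π, circleCenter a b r p = z ∧
      (a * sin p.1, b * cos p.1) = q := by
  obtain ⟨h1, h2⟩ := hq
  obtain ⟨θ, hθ, hc, hs⟩ := exists_angle_of_sq_add_sq (x := q.2 / b) (y := q.1 / a) (by
    rw [div_pow, div_pow, add_comm, h1])
  obtain ⟨φ, hφ, hc', hs'⟩ := exists_angle_of_sq_add_sq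
    (x := (q.1 - z.1) / r) (y := (q.2 - z.2) / r) (by
      rw [div_pow, div_pow, ← add_div, h2, div_self (pow_ne_zero 2 hr)])
  refine ⟨(θ, φ), ⟨hθ, hφ⟩, ?_, ?_⟩
  · simp only [circleCenter, hc, hs, hc', hs']
    rw [mul_div_cancel₀ _ ha, mul_div_cancel₀ _ hb, mul_div_cancel₀ _ hr, mul_div_cancel₀ _ hr]
    simp
  · simp only [hc, hs]
    rw [mul_div_cancel₀ _ ha, mul_div_cancel₀ _ hb]

lemma crossing_mul_crossing_nonpos {a b r : ℝ} (hb : 0 < b) (hab : b ≤ a) (hr : 0 < r)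
    (hr2 : r ≤ b ^ 2 / a) {z p q : ℝ × ℝ} (hp : p ∈ commonPoints a b r z)
    (hq : q ∈ commonPoints a b r z) (hne : p ≠ q) :
    crossing a b z p * crossing a b z q ≤ 0 := by
  have ha : 0 < a := hb.trans_le hab
  have h := cross_mul_cross_nonpos (α := (a ^ 2)⁻¹) (β := (b ^ 2)⁻¹) (r := r)
    (p₀ := p.1) (p₁ := p.2) (q₀ := q.1) (q₁ := q.2) (u₀ := p.1 - z.1) (u₁ := p.2 - z.2)
    (v₀ := q.1 - z.1) (v₁ := q.2 - z.2) (by positivity) (by gcongr)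
    (by
      have : r ^ 2 ≤ (b ^ 2 / a) ^ 2 := by gcongr
      calc r ^ 2 * (b ^ 2)⁻¹ ^ 2 ≤ (b ^ 2 / a) ^ 2 * (b ^ 2)⁻¹ ^ 2 := by gcongr
        _ = (a ^ 2)⁻¹ := by field_simp)
    (by rw [← hp.1]; ring) (by rw [← hq.1]; ring) hp.2 hq.2 (by ring) (by ring)
    (by
      by_contra! hcon
      exact hne (Prod.ext hcon.1 hcon.2))
  refine le_of_eq_of_le ?_ h
  unfold crossing
  ring

/-- A periodic differentiable function with a nondegenerate zero has another zero in each
period. -/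
lemma exists_zero_of_periodic {g : ℝ → ℝ} {T t₀ g' : ℝ} (hT : 0 < T) (hper : Function.Periodic g T)
    (hc : Continuous g) (h₀ : g t₀ = 0) (hg : HasDerivAt g g' t₀) (hg' : g' ≠ 0) :
    ∃ t ∈ Ioo t₀ (t₀ + T), g t = 0 := by
  wlog hpos : 0 < g' generalizing g g'
  · obtain ⟨t, ht, h⟩ := this (g := -g) (g' := -g') (fun x => by simp [hper x]) hc.neg (by simp [h₀])
      hg.neg (neg_ne_zero.2 hg') (by
        rw [neg_pos]; exact lt_of_le_of_ne (not_lt.1 hpos) hg')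
    exact ⟨t, ht, by simpa using h⟩
  have hgT : HasDerivAt g g' (t₀ + T) := by
    have h1 : HasDerivAt (fun x => g (x - T)) g' (t₀ + T) := by
      apply HasDerivAt.comp_sub_const
      simpa using hg
    have : (fun x => g (x - T)) = g := by
      ext x; exact hper.sub_eq x
    rwa [this] at h1
  have hgT0 : g (t₀ + T) = 0 := by rw [hper, h₀]
  obtain ⟨s, hs, hs'⟩ : ∃ s, 0 < g s ∧ s ∈ Ioo t₀ (t₀ + T / 2) := by
    have h1 := (hasDerivAt_iff_tendsto_slope.1 hg).eventually (lt_mem_nhds hpos)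
    have h2 : ∀ᶠ x in nhdsWithin t₀ (Ioi t₀), 0 < slope g t₀ x :=
      h1.filter_mono (nhdsWithin_mono _ fun x hx => ne_of_gt hx)
    obtain ⟨s, hs, hs'⟩ := (h2.and (Ioo_mem_nhdsGT (show t₀ < t₀ + T / 2 by linarith))).exists
    refine ⟨s, ?_, hs'⟩
    rw [slope_def_field, h₀, sub_zero] at hs
    exact (div_pos_iff_of_pos_right (by linarith [hs'.1])).1 hs
  obtain ⟨u, hu, hu'⟩ : ∃ u, g u < 0 ∧ u ∈ Ioo (t₀ + T / 2) (t₀ + T) := by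
    have h1 := (hasDerivAt_iff_tendsto_slope.1 hgT).eventually (lt_mem_nhds hpos)
    have h2 : ∀ᶠ x in nhdsWithin (t₀ + T) (Iio (t₀ + T)), 0 < slope g (t₀ + T) x :=
      h1.filter_mono (nhdsWithin_mono _ fun x hx => ne_of_lt hx)
    obtain ⟨s, hs, hs'⟩ :=
      (h2.and (Ioo_mem_nhdsLT (show t₀ + T / 2 < t₀ + T by linarith))).exists
    refine ⟨s, ?_, hs'⟩
    rw [slope_def_field, hgT0, sub_zero] at hs
    by_contra! hcon
    exact absurd hs (not_lt.2 (div_nonpos_of_nonneg_of_nonpos hcon (by linarith [hs'.2])))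
  obtain ⟨t, ht, hgt⟩ := intermediate_value_Icc' (show s ≤ u by linarith [hs'.2, hu'.1])
    hc.continuousOn ⟨hu.le, hs.le⟩
  exact ⟨t, ⟨by linarith [ht.1, hs'.1], by linarith [ht.2, hu'.2]⟩, hgt⟩

lemma exists_ne_mem_commonPoints {a b r : ℝ} (ha : a ≠ 0) (hb : b ≠ 0) {p : ℝ × ℝ}
    (hp : circleCenterJacobian a b r p ≠ 0) :
    ∃ q ∈ commonPoints a b r (circleCenter a b r p), q ≠ (a * sin p.1, b * cos p.1) := by
  set z := circleCenter a b r p with hz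
  obtain ⟨t, ht, hgt⟩ := exists_zero_of_periodic (t₀ := p.1) two_pi_pos
    (g := fun t => (a * sin t - z.1) ^ 2 + (b * cos t - z.2) ^ 2 - r ^ 2)
    (g' := -2 * circleCenterJacobian a b r p)
    (fun t => by simp only [sin_add_two_pi, cos_add_two_pi]) (by fun_prop)
    (by
      have := (mem_commonPoints_circleCenter (r := r) ha hb p).2
      exact sub_eq_zero.2 this)
    (by
      have h := (((((hasDerivAt_sin p.1).const_mul a).sub_const z.1).pow 2).add
        ((((hasDerivAt_cos p.1).const_mul b).sub_const z.2).pow 2)).sub_const (r ^ 2)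
      convert! h using 1
      simp only [hz, circleCenter, circleCenterJacobian]
      push_cast
      ring)
    (by simpa using hp)
  refine ⟨(a * sin t, b * cos t), ⟨?_, sub_eq_zero.1 hgt⟩, fun h => ?_⟩
  · exact (mem_commonPoints_circleCenter (r := r) ha hb (t, 0)).1
  · rw [Prod.mk.injEq] at h
    have := angle_eq_of_cos_eq_of_sin_eq (s := t) (t := p.1)
      (by rw [abs_lt]; constructor <;> linarith [ht.1, ht.2, pi_pos])
      (mul_left_cancel₀ hb h.2) (mul_left_cancel₀ ha h.1)
    exact ht.1.ne' this

/-- Parameters at which `circleCenter` preserves the orientation. -/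
def positiveParams (a b r : ℝ) : Set (ℝ × ℝ) :=
  {p ∈ Ioc (-π) π ×ˢ Ioc (-π) π | 0 < circleCenterJacobian a b r p}

lemma measurableSet_positiveParams (a b r : ℝ) : MeasurableSet (positiveParams a b r) :=
  (measurableSet_Ioc.prod measurableSet_Ioc).inter
    (measurableSet_lt measurable_const (continuous_circleCenterJacobian a b r).measurable)

lemma injOn_circleCenter {a b r : ℝ} (hb : 0 < b) (hab : b ≤ a) (hr : 0 < r)
    (hr2 : r ≤ b ^ 2 / a) : InjOn (circleCenter a b r) (positiveParams a b r) := by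
  have ha : 0 < a := hb.trans_le hab
  rintro p ⟨hpI, hp⟩ q ⟨hqI, hq⟩ hpq
  have hpt : (a * sin p.1, b * cos p.1) = (a * sin q.1, b * cos q.1) := by
    by_contra hne
    have hpm := mem_commonPoints_circleCenter (r := r) ha.ne' hb.ne' p
    have hqm := mem_commonPoints_circleCenter (r := r) ha.ne' hb.ne' q
    rw [← mul_crossing_circleCenter ha.ne' hb.ne'] at hp hq
    rw [← hpq] at hqm hq
    have h := crossing_mul_crossing_nonpos hb hab hr hr2 hpm hqm hne
    have := mul_pos hp hq
    nlinarith [mul_nonneg (sq_nonneg (a * b)) (neg_nonneg.2 h)]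
  rw [Prod.mk.injEq] at hpt
  have hs := mul_left_cancel₀ ha.ne' hpt.1
  have hc := mul_left_cancel₀ hb.ne' hpt.2
  simp only [circleCenter, Prod.mk.injEq, hs, hc, sub_right_inj] at hpq
  exact Prod.ext (angle_eq_of_cos_eq_of_sin_eq (abs_sub_lt_two_pi hpI.1 hqI.1) hc hs)
    (angle_eq_of_cos_eq_of_sin_eq (abs_sub_lt_two_pi hpI.2 hqI.2)
      (mul_left_cancel₀ hr.ne' hpq.1) (mul_left_cancel₀ hr.ne' hpq.2))

/-- The centers of circles tangent to the ellipse form a null set. -/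
lemma volume_image_jacobian_eq_zero (a b r : ℝ) :
    volume (circleCenter a b r '' {p | circleCenterJacobian a b r p = 0}) = 0 :=
  addHaar_image_eq_zero_of_det_fderivWithin_eq_zero volume
    (fun p _ => (hasFDerivAt_circleCenter a b r p).hasFDerivWithinAt)
    fun p hp => by rw [det_fderivCircleCenter]; exact hp

/-- Away from the centers of tangent circles, the circle centered at `z` meets the ellipse in two
points if and only if it crosses it positively somewhere. -/
lemma ncard_commonPoints_eq_two_iff {a b r : ℝ} (hb : 0 < b) (hab : b ≤ a) (hr : 0 < r)
    (hr2 : r ≤ b ^ 2 / a) {z : ℝ × ℝ}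
    (hz : z ∉ circleCenter a b r '' {p | circleCenterJacobian a b r p = 0}) :
    (commonPoints a b r z).ncard = 2 ↔ z ∈ circleCenter a b r '' positiveParams a b r := by
  have ha : 0 < a := hb.trans_le hab
  have hab0 : 0 < a * b := mul_pos ha hb
  have hne : ∀ q ∈ commonPoints a b r z, crossing a b z q ≠ 0 := by
    intro q hq h0
    obtain ⟨p, -, rfl, rfl⟩ := exists_circleCenter_eq ha.ne' hb.ne' hr.ne' hq
    refine hz ⟨p, ?_, rfl⟩
    change circleCenterJacobian a b r p = 0
    rw [← mul_crossing_circleCenter ha.ne' hb.ne', h0, mul_zero]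
  have hneg : ∀ p ∈ commonPoints a b r z, ∀ q ∈ commonPoints a b r z, p ≠ q →
      0 < crossing a b z p → crossing a b z q < 0 := by
    intro p hp q hq hpq hpos
    refine lt_of_le_of_ne ?_ (hne q hq)
    by_contra! hcon
    exact absurd (crossing_mul_crossing_nonpos hb hab hr hr2 hp hq hpq)
      (not_le.2 (mul_pos hpos hcon))
  constructor
  · intro h
    obtain ⟨p, q, hpq, hS⟩ := ncard_eq_two.1 h
    have hp : p ∈ commonPoints a b r z := by rw [hS]; simp
    have hq : q ∈ commonPoints a b r z := by rw [hS]; simp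
    obtain ⟨s, hs, hpos⟩ : ∃ s ∈ commonPoints a b r z, 0 < crossing a b z s := by
      by_contra! hcon
      have h1 := lt_of_le_of_ne (hcon p hp) (hne p hp)
      have h2 := lt_of_le_of_ne (hcon q hq) (hne q hq)
      exact absurd (crossing_mul_crossing_nonpos hb hab hr hr2 hp hq hpq)
        (not_le.2 (mul_pos_of_neg_of_neg h1 h2))
    obtain ⟨t, htI, rfl, rfl⟩ := exists_circleCenter_eq ha.ne' hb.ne' hr.ne' hs
    refine ⟨t, ⟨htI, ?_⟩, rfl⟩
    rw [← mul_crossing_circleCenter ha.ne' hb.ne']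
    exact mul_pos hab0 hpos
  · rintro ⟨p, ⟨-, hp⟩, rfl⟩
    obtain ⟨q, hq, hqne⟩ := exists_ne_mem_commonPoints ha.ne' hb.ne' hp.ne'
    have hpm := mem_commonPoints_circleCenter (r := r) ha.ne' hb.ne' p
    rw [← mul_crossing_circleCenter ha.ne' hb.ne'] at hp
    have hp' := (mul_pos_iff_of_pos_left hab0).1 hp
    rw [ncard_eq_two]
    refine ⟨_, q, hqne.symm, Subset.antisymm (fun s hs => ?_) ?_⟩
    · by_contra hcon
      simp only [mem_insert_iff, mem_singleton_iff, not_or] at hcon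
      have h1 := hneg _ hpm q hq hqne.symm hp'
      have h2 := hneg _ hpm s hs (Ne.symm hcon.1) hp'
      exact absurd (crossing_mul_crossing_nonpos hb hab hr hr2 hs hq hcon.2)
        (not_le.2 (mul_pos_of_neg_of_neg h2 h1))
    · rintro s (rfl | rfl)
      exacts [hpm, hq]

lemma lintegral_jacobian {a b r : ℝ} (hb : 0 < b) (hab : b ≤ a) (hr : 0 < r) :
    ∫⁻ p in positiveParams a b r, ENNReal.ofReal |circleCenterJacobian a b r p| =
      ENNReal.ofReal (8 * r * a * Ecomp (ecc a b)) := by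
  have hpi : -π ≤ π := by linarith [pi_pos]
  set J := circleCenterJacobian a b r with hJ
  have hJc : Continuous J := continuous_circleCenterJacobian a b r
  have hset : positiveParams a b r = {p | 0 < J p} ∩ Ioc (-π) π ×ˢ Ioc (-π) π := by
    rw [inter_comm]; rfl
  have hinner : ∀ θ : ℝ, ∫⁻ φ in Ioc (-π) π, ENNReal.ofReal (max (J (θ, φ)) 0) =
      ENNReal.ofReal (2 * r * √(a ^ 2 * cos θ ^ 2 + b ^ 2 * sin θ ^ 2)) := by
    intro θ
    have hc : Continuous fun φ => max (J (θ, φ)) 0 := by fun_prop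
    rw [← ofReal_integral_eq_lintegral_ofReal
      (hc.integrableOn_Icc.mono_set Ioc_subset_Icc_self)
      (Filter.Eventually.of_forall fun φ => le_max_right _ _),
      ← intervalIntegral.integral_of_le hpi]
    congr 1
    have h : ∀ φ, max (J (θ, φ)) 0
        = r * max (-(a * cos θ) * cos φ + b * sin θ * sin φ) 0 := by
      intro φ
      rw [mul_max_of_nonneg _ _ hr.le, mul_zero, hJ, circleCenterJacobian]
      ring_nf
    simp_rw [h]
    rw [intervalIntegral.integral_const_mul, integral_max_cos_sin, neg_sq, mul_pow, mul_pow]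
    ring
  calc ∫⁻ p in positiveParams a b r, ENNReal.ofReal |J p|
      = ∫⁻ p in Ioc (-π) π ×ˢ Ioc (-π) π, ENNReal.ofReal (max (J p) 0) := by
        have hm : MeasurableSet {p | 0 < J p} := measurableSet_lt measurable_const hJc.measurable
        rw [hset, ← Measure.restrict_restrict hm, ← lintegral_indicator hm]
        congr 1
        ext p
        by_cases hp : 0 < J p
        · rw [indicator_of_mem (by exact hp), abs_of_pos hp, max_eq_left hp.le]
        · rw [indicator_of_notMem (by exact hp), max_eq_right (not_lt.1 hp), ENNReal.ofReal_zero]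
    _ = ∫⁻ θ in Ioc (-π) π, ∫⁻ φ in Ioc (-π) π, ENNReal.ofReal (max (J (θ, φ)) 0) := by
        rw [Measure.volume_eq_prod, ← Measure.prod_restrict, lintegral_prod]
        exact (ENNReal.continuous_ofReal.comp (hJc.max continuous_const)).measurable.aemeasurable
    _ = ENNReal.ofReal (8 * r * a * Ecomp (ecc a b)) := by
        simp_rw [hinner]
        have hc : Continuous fun θ => 2 * r * √(a ^ 2 * cos θ ^ 2 + b ^ 2 * sin θ ^ 2) := by
          fun_prop
        rw [← ofReal_integral_eq_lintegral_ofReal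
          (hc.integrableOn_Icc.mono_set Ioc_subset_Icc_self)
          (Filter.Eventually.of_forall fun θ => by positivity),
          ← intervalIntegral.integral_of_le hpi, intervalIntegral.integral_const_mul,
          integral_sqrt_eq_Ecomp hb hab]
        congr 1
        ring

lemma volume_ncard_commonPoints_eq_two {a b r : ℝ} (hb : 0 < b) (hab : b ≤ a) (hr : 0 < r)
    (hr2 : r ≤ b ^ 2 / a) :
    volume {z | (commonPoints a b r z).ncard = 2} =
      ENNReal.ofReal (8 * r * a * Ecomp (ecc a b)) := by
  have hae : {z | (commonPoints a b r z).ncard = 2} =ᵐ[volume]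
      circleCenter a b r '' positiveParams a b r := by
    have h := measure_eq_zero_iff_ae_notMem.1 (volume_image_jacobian_eq_zero a b r)
    filter_upwards [h] with z hz
    exact propext (ncard_commonPoints_eq_two_iff hb hab hr hr2 hz)
  rw [measure_congr hae, ← lintegral_jacobian hb hab hr,
    ← lintegral_abs_det_fderiv_eq_addHaar_image volume (measurableSet_positiveParams a b r)
      (fun p _ => (hasFDerivAt_circleCenter a b r p).hasFDerivWithinAt)
      (injOn_circleCenter hb hab hr hr2)]
  simp_rw [det_fderivCircleCenter]

/-- The Euclidean plane is measurably equivalent to `ℝ × ℝ` through its coordinates. -/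
def planeEquivProd : E2 ≃ᵐ ℝ × ℝ :=
  (MeasurableEquiv.toLp 2 (Fin 2 → ℝ)).symm.trans MeasurableEquiv.finTwoArrow

lemma planeEquivProd_apply (x : E2) : planeEquivProd x = (x 0, x 1) := rfl

lemma measurePreserving_planeEquivProd : MeasurePreserving planeEquivProd :=
  (volume_preserving_finTwoArrow ℝ).comp
    (EuclideanSpace.volume_preserving_symm_measurableEquiv_toLp (Fin 2))

lemma ncard_sphere_inter_Cset {a b r : ℝ} (hr : 0 < r) (x : E2) :
    (sphere x r ∩ Cset a b).ncard = (commonPoints a b r (planeEquivProd x)).ncard := by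
  have : sphere x r ∩ Cset a b = planeEquivProd ⁻¹' commonPoints a b r (planeEquivProd x) := by
    ext y
    simp only [commonPoints, Cset, planeEquivProd_apply, mem_inter_iff, mem_sphere, mem_preimage,
      mem_ofPred_eq, EuclideanSpace.dist_eq, Fin.sum_univ_two, Real.dist_eq, sq_abs]
    rw [sqrt_eq_iff_eq_sq (by positivity) hr.le, and_comm]
  rw [this, ncard_preimage_of_injective_subset_range planeEquivProd.injective]
  rw [planeEquivProd.surjective.range_eq]
  exact subset_univ _

/-- Case 1 of Lemma 1: for `0 < r ≤ b²/a`, the area of the set of centers `x` for which the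
circle of radius `r` about `x` meets the ellipse in exactly two points is `8raE(ε)`. -/
theorem area_two_intersections_case1 (a b r : ℝ) (hb : 0 < b) (hab : b ≤ a)
    (hr : 0 < r) (hr2 : r ≤ b^2 / a) :
    volume {x : E2 | (sphere x r ∩ Cset a b).ncard = 2} =
      ENNReal.ofReal (8 * r * a * Ecomp (ecc a b)) := by
  simp_rw [ncard_sphere_inter_Cset hr]
  rw [← volume_ncard_commonPoints_eq_two hb hab hr hr2]
  exact measurePreserving_planeEquivProd.measure_preimage_equiv
    {z | (commonPoints a b r z).ncard = 2}
end
end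

section
/- Let a > b > 0 and b²/a < r < b. Then the area of the set {x ∈ ℝ² : closedBall(x,r) ⊆ K(a,b)} equals A* − F(α), where A* = πr² + πab − 4raE(ε), F(φ) = 2r²φ + 2ab·arctan((b/a)tanφ) − 4ra·E(φ,ε) + raε² sin(2φ)/√(1−ε² sin²φ), and α = arctan( √(r²a² − b⁴) / (b√(b² − r²)) ). -/
open Real MeasureTheory Set Metric

noncomputable section

/-- The antiderivative `F(φ)` from the paper's Lemma 1. -/
def Ffun (a b r φ : ℝ) : ℝ :=
  2*r^2*φ + 2*a*b*Real.arctan ((b/a)*Real.tan φ) - 4*r*a*Einc (ecc a b) φ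
    + r*a*(ecc a b)^2 * Real.sin (2*φ) / Real.sqrt (1 - (ecc a b)^2 * Real.sin φ^2)
/-- The quantity `A* = πr² + πab − 4raE(ε)`. -/
def Astar (a b r : ℝ) : ℝ := π*r^2 + π*a*b - 4*r*a*Ecomp (ecc a b)
/-- The angle `α` from Case 2 of the paper's Lemma 1. -/
def alphaAng (a b r : ℝ) : ℝ :=
  Real.arctan (Real.sqrt (r^2*a^2 - b^4) / (b * Real.sqrt (b^2 - r^2)))

/-- Support function of `Kset a b` in the direction `(cos t, sin t)`. -/
def ellipseSupport (a b t : ℝ) : ℝ := Real.sqrt (a^2 * Real.cos t^2 + b^2 * Real.sin t^2)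

/-- Radius of curvature of the ellipse at the point with outer normal `(cos t, sin t)`. -/
def ellipseCurvRadius (a b t : ℝ) : ℝ := a^2 * b^2 / ellipseSupport a b t^3

/-- First coordinate of the inner parallel curve of the ellipse at distance `r`. -/
def parallelX (a b r t : ℝ) : ℝ := (a^2 / ellipseSupport a b t - r) * Real.cos t

/-- Second coordinate of the inner parallel curve of the ellipse at distance `r`. -/
def parallelY (a b r t : ℝ) : ℝ := (b^2 / ellipseSupport a b t - r) * Real.sin t

/-- Coordinate description of the centers of the disks of radius `r` contained in `Kset a b`. -/
def ellipseErosion (a b r : ℝ) : Set (ℝ × ℝ) :=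
  {p | ∀ v w : ℝ, v^2 + w^2 ≤ r^2 → (p.1 + v)^2 / a^2 + (p.2 + w)^2 / b^2 ≤ 1}

section Support

variable {a b : ℝ}

lemma ellipseSupport_sq (a b t : ℝ) :
    ellipseSupport a b t^2 = a^2 * Real.cos t^2 + b^2 * Real.sin t^2 :=
  Real.sq_sqrt (by positivity)

lemma ellipseSupport_pos (ha : 0 < a) (hb : 0 < b) (t : ℝ) : 0 < ellipseSupport a b t := by
  apply Real.sqrt_pos.2
  rcases eq_or_ne (Real.cos t) 0 with h | h
  · have : Real.sin t ^ 2 = 1 := by have := Real.sin_sq_add_cos_sq t; rw [h] at this; linarith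
    rw [h, this]; positivity
  · positivity

lemma continuous_ellipseSupport (a b : ℝ) : Continuous (ellipseSupport a b) := by
  unfold ellipseSupport; fun_prop

lemma ellipseSupport_pi_sub (a b t : ℝ) : ellipseSupport a b (π - t) = ellipseSupport a b t := by
  simp [ellipseSupport]

lemma ellipseSupport_neg (a b t : ℝ) : ellipseSupport a b (-t) = ellipseSupport a b t := by
  simp [ellipseSupport]

lemma hasDerivAt_ellipseSupport (ha : 0 < a) (hb : 0 < b) (t : ℝ) :
    HasDerivAt (ellipseSupport a b)
      (-((a^2 - b^2) * Real.sin t * Real.cos t) / ellipseSupport a b t) t := by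
  have hpos := ellipseSupport_pos ha hb t
  have h1 : HasDerivAt (fun t => a^2 * Real.cos t^2 + b^2 * Real.sin t^2)
      (a^2 * (2 * Real.cos t * (-Real.sin t)) + b^2 * (2 * Real.sin t * Real.cos t)) t := by
    refine ((((Real.hasDerivAt_cos t).pow 2).const_mul (a^2)).add
      (((Real.hasDerivAt_sin t).pow 2).const_mul (b^2))).congr_deriv ?_
    simp
  have h2 := h1.sqrt (Real.sqrt_pos.1 hpos).ne'
  refine h2.congr_deriv ?_
  change _ / (2 * ellipseSupport a b t) = _
  field_simp
  ring

lemma hasDerivAt_parallelX (ha : 0 < a) (hb : 0 < b) (r t : ℝ) :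
    HasDerivAt (parallelX a b r) (-((ellipseCurvRadius a b t - r) * Real.sin t)) t := by
  have hpos := ellipseSupport_pos ha hb t
  have h := (((hasDerivAt_const t (a^2)).div (hasDerivAt_ellipseSupport ha hb t) hpos.ne').sub_const
    r).mul (Real.hasDerivAt_cos t)
  refine h.congr_deriv ?_
  have hs := ellipseSupport_sq a b t
  have hc := Real.sin_sq_add_cos_sq t
  simp only [ellipseCurvRadius, Pi.div_apply]
  generalize ellipseSupport a b t = k at *
  field_simp
  have e1 : Real.sin t ^ 2 = 1 - Real.cos t ^ 2 := by linarith
  rw [e1] at hs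
  linear_combination (-(Real.sin t) * a^2) * hs

lemma hasDerivAt_parallelY (ha : 0 < a) (hb : 0 < b) (r t : ℝ) :
    HasDerivAt (parallelY a b r) ((ellipseCurvRadius a b t - r) * Real.cos t) t := by
  have hpos := ellipseSupport_pos ha hb t
  have h := (((hasDerivAt_const t (b^2)).div (hasDerivAt_ellipseSupport ha hb t) hpos.ne').sub_const
    r).mul (Real.hasDerivAt_sin t)
  refine h.congr_deriv ?_
  have hs := ellipseSupport_sq a b t
  have hc := Real.sin_sq_add_cos_sq t
  simp only [ellipseCurvRadius, Pi.div_apply]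
  generalize ellipseSupport a b t = k at *
  field_simp
  have e1 : Real.cos t ^ 2 = 1 - Real.sin t ^ 2 := by linarith
  rw [e1] at hs
  linear_combination (Real.cos t * b^2) * hs

lemma continuous_ellipseCurvRadius (ha : 0 < a) (hb : 0 < b) :
    Continuous (ellipseCurvRadius a b) :=
  continuous_const.div ((continuous_ellipseSupport a b).pow 3)
    fun t => (pow_pos (ellipseSupport_pos ha hb t) 3).ne'

lemma continuous_parallelX (ha : 0 < a) (hb : 0 < b) (r : ℝ) : Continuous (parallelX a b r) :=
  continuous_iff_continuousAt.2 fun t => (hasDerivAt_parallelX ha hb r t).continuousAt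

lemma continuous_parallelY (ha : 0 < a) (hb : 0 < b) (r : ℝ) : Continuous (parallelY a b r) :=
  continuous_iff_continuousAt.2 fun t => (hasDerivAt_parallelY ha hb r t).continuousAt

lemma parallelX_mul_cos_add_parallelY_mul_sin (ha : 0 < a) (hb : 0 < b) (r t : ℝ) :
    parallelX a b r t * Real.cos t + parallelY a b r t * Real.sin t = ellipseSupport a b t - r := by
  have hpos := ellipseSupport_pos ha hb t
  have hs := ellipseSupport_sq a b t
  have hc := Real.sin_sq_add_cos_sq t
  unfold parallelX parallelY
  field_simp
  linear_combination (-r * ellipseSupport a b t) * hc - hs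

lemma parallelX_pi_sub (a b r t : ℝ) : parallelX a b r (π - t) = -parallelX a b r t := by
  simp [parallelX, ellipseSupport_pi_sub]

lemma parallelY_pi_sub (a b r t : ℝ) : parallelY a b r (π - t) = parallelY a b r t := by
  simp [parallelY, ellipseSupport_pi_sub]

end Support

section Erosion

variable {a b r : ℝ}

lemma isClosed_ellipseErosion (a b r : ℝ) : IsClosed (ellipseErosion a b r) := by
  simp only [ellipseErosion, ofPred_forall]
  refine isClosed_iInter fun v => isClosed_iInter fun w => isClosed_iInter fun _ => ?_
  exact isClosed_le (by fun_prop) continuous_const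

lemma le_support_of_mem_ellipseErosion (ha : 0 < a) (hb : 0 < b) {p : ℝ × ℝ}
    (hp : p ∈ ellipseErosion a b r) (u : ℝ) :
    p.1 * Real.cos u + p.2 * Real.sin u ≤ ellipseSupport a b u - r := by
  have hc := Real.sin_sq_add_cos_sq u
  have h := hp (r * Real.cos u) (r * Real.sin u) (le_of_eq (by linear_combination r^2 * hc))
  set x := p.1 + r * Real.cos u with hx
  set y := p.2 + r * Real.sin u with hy
  have key : x * Real.cos u + y * Real.sin u ≤ ellipseSupport a b u := by
    refine (le_abs_self _).trans (Real.abs_le_sqrt ?_)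
    have h2 := mul_le_mul_of_nonneg_right h
      (show 0 ≤ a^2 * Real.cos u^2 + b^2 * Real.sin u^2 by positivity)
    rw [one_mul] at h2
    refine le_trans ?_ h2
    have : (x ^ 2 / a ^ 2 + y ^ 2 / b ^ 2) * (a ^ 2 * Real.cos u ^ 2 + b ^ 2 * Real.sin u ^ 2)
        - (x * Real.cos u + y * Real.sin u)^2
        = (x * b / a * Real.sin u - y * a / b * Real.cos u)^2 := by
      field_simp; ring
    nlinarith [sq_nonneg (x * b / a * Real.sin u - y * a / b * Real.cos u)]
  have e : x * Real.cos u + y * Real.sin u = p.1 * Real.cos u + p.2 * Real.sin u + r := by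
    rw [hx, hy]; linear_combination r * hc
  linarith

lemma mem_ellipseErosion_of_abs_le {x y z : ℝ} (hp : (x, z) ∈ ellipseErosion a b r)
    (hy : |y| ≤ z) : (x, y) ∈ ellipseErosion a b r := by
  intro v w hvw
  have h1 := hp v w hvw
  have h2 := hp v (-w) (by simpa using hvw)
  simp only at h1 h2 ⊢
  obtain ⟨hy1, hy2⟩ := abs_le.1 hy
  rcases le_total 0 (y + w) with h | h
  · have : (y + w)^2 ≤ (z + w)^2 := pow_le_pow_left₀ h (by linarith) 2
    have := div_le_div_of_nonneg_right this (sq_nonneg b)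
    linarith
  · have : (y + w)^2 ≤ (z + -w)^2 := by
      rw [← neg_sq (y + w)]; exact pow_le_pow_left₀ (by linarith) (by linarith) 2
    have := div_le_div_of_nonneg_right this (sq_nonneg b)
    linarith

lemma parallel_mem_ellipseErosion (hb : 0 < b) (hba : b < a) (hr : 0 < r) {t : ℝ}
    (ht : ellipseSupport a b t * r ≤ b^2) :
    (parallelX a b r t, parallelY a b r t) ∈ ellipseErosion a b r := by
  intro v w hvw
  have ha : 0 < a := hb.trans hba
  have hpos := ellipseSupport_pos ha hb t
  have hs := ellipseSupport_sq a b t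
  have hc := Real.sin_sq_add_cos_sq t
  simp only [parallelX, parallelY]
  generalize ellipseSupport a b t = k at *
  set c := Real.cos t
  set s := Real.sin t
  set m := v - r * c with hm
  set n := w - r * s with hn
  have hv : (a^2 / k - r) * c + v = a^2 * c / k + m := by rw [hm]; ring
  have hw : (b^2 / k - r) * s + w = b^2 * s / k + n := by rw [hn]; ring
  rw [hv, hw]
  have h1 : m^2 + n^2 + 2 * r * (m * c + n * s) ≤ 0 := by
    have : m^2 + n^2 + 2 * r * (m * c + n * s) = v^2 + w^2 - r^2 * (s^2 + c^2) := by
      rw [hm, hn]; ring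
    rw [this, hc]; linarith
  have h2 : (a^2 * c / k + m)^2 / a^2 + (b^2 * s / k + n)^2 / b^2
      = 1 + 2 * (m * c + n * s) / k + (m^2 / a^2 + n^2 / b^2) := by
    field_simp
    linear_combination (-(a^2 * b^2)) * hs
  have h3 : m^2 / a^2 ≤ m^2 / b^2 :=
    div_le_div_of_nonneg_left (sq_nonneg m) (by positivity) (by nlinarith)
  have h4 : (m^2 + n^2) / b^2 ≤ (m^2 + n^2) / (k * r) :=
    div_le_div_of_nonneg_left (by positivity) (by positivity) ht
  have h5 : (m^2 + n^2) / (k * r) + 2 * (m * c + n * s) / k ≤ 0 := by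
    have : (m^2 + n^2) / (k * r) + 2 * (m * c + n * s) / k
        = (m^2 + n^2 + 2 * r * (m * c + n * s)) / (k * r) := by field_simp
    rw [this]
    exact div_nonpos_of_nonpos_of_nonneg h1 (by positivity)
  rw [h2]
  rw [add_div] at h4
  linarith

lemma volume_closedBall_subset_Kset (hr : 0 < r) :
    volume {x : E2 | closedBall x r ⊆ Kset a b} = volume (ellipseErosion a b r) := by
  have hmp := (volume_preserving_finTwoArrow ℝ).comp
    (EuclideanSpace.volume_preserving_symm_measurableEquiv_toLp (Fin 2))
  rw [← hmp.measure_preimage (isClosed_ellipseErosion a b r).measurableSet.nullMeasurableSet]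
  congr 1
  ext x
  simp only [mem_ofPred_eq, mem_preimage]
  change _ ↔ ∀ v w : ℝ, v^2 + w^2 ≤ r^2 → (x 0 + v)^2 / a^2 + (x 1 + w)^2 / b^2 ≤ 1
  constructor
  · intro h v w hvw
    have : x + !₂[v, w] ∈ closedBall x r := by
      rw [mem_closedBall, dist_eq_norm, add_sub_cancel_left, EuclideanSpace.norm_eq]
      simp only [Fin.sum_univ_two, Real.norm_eq_abs, sq_abs]
      exact Real.sqrt_le_iff.2 ⟨hr.le, by simpa using hvw⟩
    simpa [Kset] using h this
  · intro h y hy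
    rw [mem_closedBall, dist_eq_norm, EuclideanSpace.norm_eq] at hy
    simp only [Fin.sum_univ_two, Real.norm_eq_abs, sq_abs] at hy
    have := h (y 0 - x 0) (y 1 - x 1) (by simpa using (Real.sqrt_le_iff.1 hy).2)
    simpa [Kset] using this

end Erosion

section Angle

variable {a b r : ℝ}

lemma sq_lt_mul_of_div_lt (ha : 0 < a) (hr1 : b^2 / a < r) : b^2 < r * a :=
  (div_lt_iff₀ ha).1 hr1

lemma alphaAng_pos (hb : 0 < b) (hba : b < a) (hr1 : b^2 / a < r) (hr2 : r < b) :
    0 < alphaAng a b r := by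
  have h := sq_lt_mul_of_div_lt (hb.trans hba) hr1
  have hr : 0 < r := lt_of_le_of_lt (by have := hb.trans hba; positivity) hr1
  have h1 : 0 < r^2 * a^2 - b^4 := by nlinarith [sq_nonneg b]
  have h2 : 0 < b^2 - r^2 := by nlinarith
  apply Real.arctan_pos.2
  positivity

lemma alphaAng_lt_pi_div_two (a b r : ℝ) : alphaAng a b r < π / 2 := Real.arctan_lt_pi_div_two _

lemma cos_sq_alphaAng (hb : 0 < b) (hba : b < a) (hr1 : b^2 / a < r) (hr2 : r < b) :
    (a^2 - b^2) * Real.cos (alphaAng a b r)^2 = b^4 / r^2 - b^2 := by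
  have h := sq_lt_mul_of_div_lt (hb.trans hba) hr1
  have hr : 0 < r := lt_of_le_of_lt (by have := hb.trans hba; positivity) hr1
  have h1 : 0 < r^2 * a^2 - b^4 := by nlinarith [sq_nonneg b]
  have h2 : 0 < b^2 - r^2 := by nlinarith
  have h3 : 0 < a^2 - b^2 := by nlinarith
  rw [alphaAng, Real.cos_sq_arctan, div_pow, mul_pow, Real.sq_sqrt h1.le, Real.sq_sqrt h2.le]
  have h4 : 1 + (r^2 * a^2 - b^4) / (b^2 * (b^2 - r^2))
      = r^2 * (a^2 - b^2) / (b^2 * (b^2 - r^2)) := by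
    field_simp; ring
  rw [h4]
  field_simp

lemma ellipseSupport_alphaAng (hb : 0 < b) (hba : b < a) (hr1 : b^2 / a < r) (hr2 : r < b) :
    ellipseSupport a b (alphaAng a b r) = b^2 / r := by
  have hr : 0 < r := lt_of_le_of_lt (by have := hb.trans hba; positivity) hr1
  rw [ellipseSupport, Real.sqrt_eq_iff_mul_self_eq_of_pos (by positivity), ← sq]
  have h := cos_sq_alphaAng hb hba hr1 hr2
  have hc := Real.sin_sq_add_cos_sq (alphaAng a b r)
  rw [div_pow]
  linear_combination -h - b^2 * hc

lemma ellipseSupport_mul_le (hb : 0 < b) (hba : b < a) (hr1 : b^2 / a < r) (hr2 : r < b) {t : ℝ}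
    (ht : t ∈ Icc (alphaAng a b r) (π - alphaAng a b r)) : ellipseSupport a b t * r ≤ b^2 := by
  have hr : 0 < r := lt_of_le_of_lt (by have := hb.trans hba; positivity) hr1
  have hα := alphaAng_pos hb hba hr1 hr2
  rw [← le_div_iff₀ hr, ← ellipseSupport_alphaAng hb hba hr1 hr2]
  apply Real.sqrt_le_sqrt
  have h1 : Real.cos t ≤ Real.cos (alphaAng a b r) :=
    Real.cos_le_cos_of_nonneg_of_le_pi hα.le (by linarith [ht.2]) ht.1
  have h2 : Real.cos (π - t) ≤ Real.cos (alphaAng a b r) :=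
    Real.cos_le_cos_of_nonneg_of_le_pi hα.le (by linarith [ht.1]) (by linarith [ht.2])
  rw [Real.cos_pi_sub] at h2
  have h3 : Real.cos t^2 ≤ Real.cos (alphaAng a b r)^2 := sq_le_sq' (by linarith) h1
  have e1 := Real.sin_sq_add_cos_sq t
  have e2 := Real.sin_sq_add_cos_sq (alphaAng a b r)
  have h4 : 0 ≤ a^2 - b^2 := by nlinarith
  linear_combination (a^2 - b^2) * h3 + b^2 * e1 - b^2 * e2

lemma sin_pos_of_mem_arc (hb : 0 < b) (hba : b < a) (hr1 : b^2 / a < r) (hr2 : r < b) {t : ℝ}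
    (ht : t ∈ Icc (alphaAng a b r) (π - alphaAng a b r)) : 0 < Real.sin t := by
  have hα := alphaAng_pos hb hba hr1 hr2
  exact Real.sin_pos_of_pos_of_lt_pi (by linarith [ht.1]) (by linarith [ht.2])

lemma lt_ellipseCurvRadius (hb : 0 < b) (hba : b < a) (hr1 : b^2 / a < r) (hr2 : r < b) {t : ℝ}
    (ht : t ∈ Icc (alphaAng a b r) (π - alphaAng a b r)) : r < ellipseCurvRadius a b t := by
  have ha := hb.trans hba
  have hr : 0 < r := lt_of_le_of_lt (by positivity) hr1
  have h := sq_lt_mul_of_div_lt ha hr1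
  have hk := ellipseSupport_mul_le hb hba hr1 hr2 ht
  have hpos := ellipseSupport_pos ha hb t
  rw [ellipseCurvRadius, lt_div_iff₀ (by positivity)]
  generalize ellipseSupport a b t = k at *
  have h1 : (k * r)^3 ≤ (b^2)^3 := pow_le_pow_left₀ (by positivity) hk 3
  have h2 : (b^2)^2 < (r * a)^2 := pow_lt_pow_left₀ h (by positivity) (by norm_num)
  have h3 : r^2 * (r * k^3) < r^2 * (a^2 * b^2) := by
    nlinarith [mul_lt_mul_of_pos_left h2 (show 0 < b^2 by positivity)]
  exact lt_of_mul_lt_mul_left h3 (by positivity)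

lemma parallelY_nonneg (hb : 0 < b) (hba : b < a) (hr1 : b^2 / a < r) (hr2 : r < b) {t : ℝ}
    (ht : t ∈ Icc (alphaAng a b r) (π - alphaAng a b r)) : 0 ≤ parallelY a b r t := by
  have hk := ellipseSupport_mul_le hb hba hr1 hr2 ht
  have hpos := ellipseSupport_pos (hb.trans hba) hb t
  refine mul_nonneg (sub_nonneg.2 ?_) (sin_pos_of_mem_arc hb hba hr1 hr2 ht).le
  rw [le_div_iff₀ hpos]; linarith

lemma parallelY_alphaAng (hb : 0 < b) (hba : b < a) (hr1 : b^2 / a < r) (hr2 : r < b) :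
    parallelY a b r (alphaAng a b r) = 0 := by
  have hr : 0 < r := lt_of_le_of_lt (by have := hb.trans hba; positivity) hr1
  rw [parallelY, ellipseSupport_alphaAng hb hba hr1 hr2]
  field_simp
  ring

lemma injOn_parallelX (hb : 0 < b) (hba : b < a) (hr1 : b^2 / a < r) (hr2 : r < b) :
    InjOn (parallelX a b r) (Icc (alphaAng a b r) (π - alphaAng a b r)) := by
  have ha := hb.trans hba
  refine (strictAntiOn_of_deriv_neg (convex_Icc _ _)
    (continuous_parallelX ha hb r).continuousOn fun t ht => ?_).injOn
  have ht' := interior_subset ht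
  rw [(hasDerivAt_parallelX ha hb r t).deriv, neg_lt_zero]
  exact mul_pos (sub_pos.2 (lt_ellipseCurvRadius hb hba hr1 hr2 ht'))
    (sin_pos_of_mem_arc hb hba hr1 hr2 ht')

lemma fst_mem_image_of_mem_ellipseErosion (hb : 0 < b) (hba : b < a) (hr1 : b^2 / a < r)
    (hr2 : r < b) {p : ℝ × ℝ} (hp : p ∈ ellipseErosion a b r) :
    p.1 ∈ parallelX a b r '' Icc (alphaAng a b r) (π - alphaAng a b r) := by
  have ha := hb.trans hba
  have hα := alphaAng_pos hb hba hr1 hr2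
  have hα' := alphaAng_lt_pi_div_two a b r
  have hcos : 0 < Real.cos (alphaAng a b r) :=
    Real.cos_pos_of_mem_Ioo ⟨by linarith, hα'⟩
  refine intermediate_value_Icc' (by linarith) (continuous_parallelX ha hb r).continuousOn ?_
  have h0 := parallelX_mul_cos_add_parallelY_mul_sin ha hb r (alphaAng a b r)
  rw [parallelY_alphaAng hb hba hr1 hr2, zero_mul, add_zero] at h0
  have h1 := le_support_of_mem_ellipseErosion ha hb hp (alphaAng a b r)
  have h2 := le_support_of_mem_ellipseErosion ha hb hp (-alphaAng a b r)
  have h3 := le_support_of_mem_ellipseErosion ha hb hp (π - alphaAng a b r)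
  have h4 := le_support_of_mem_ellipseErosion ha hb hp (-(π - alphaAng a b r))
  simp only [ellipseSupport_neg, ellipseSupport_pi_sub, Real.cos_neg, Real.sin_neg,
    Real.cos_pi_sub, Real.sin_pi_sub] at h1 h2 h3 h4
  rw [parallelX_pi_sub]
  constructor
  · refine le_of_mul_le_mul_right ?_ hcos
    linarith
  · refine le_of_mul_le_mul_right ?_ hcos
    linarith

lemma slice_ellipseErosion (hb : 0 < b) (hba : b < a) (hr1 : b^2 / a < r) (hr2 : r < b) {t : ℝ}
    (ht : t ∈ Icc (alphaAng a b r) (π - alphaAng a b r)) :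
    Prod.mk (parallelX a b r t) ⁻¹' ellipseErosion a b r
      = Icc (-parallelY a b r t) (parallelY a b r t) := by
  have ha := hb.trans hba
  have hr : 0 < r := lt_of_le_of_lt (by positivity) hr1
  have hsin := sin_pos_of_mem_arc hb hba hr1 hr2 ht
  have h0 := parallelX_mul_cos_add_parallelY_mul_sin ha hb r t
  ext y
  rw [mem_preimage, mem_Icc, ← abs_le]
  refine ⟨fun hp => ?_, mem_ellipseErosion_of_abs_le
    (parallel_mem_ellipseErosion hb hba hr (ellipseSupport_mul_le hb hba hr1 hr2 ht))⟩
  have h1 := le_support_of_mem_ellipseErosion ha hb hp t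
  have h2 := le_support_of_mem_ellipseErosion ha hb hp (-t)
  simp only [ellipseSupport_neg, Real.cos_neg, Real.sin_neg] at h1 h2
  rw [abs_le]
  constructor
  · refine le_of_mul_le_mul_right ?_ hsin
    linarith
  · refine le_of_mul_le_mul_right ?_ hsin
    linarith

lemma volume_ellipseErosion (hb : 0 < b) (hba : b < a) (hr1 : b^2 / a < r) (hr2 : r < b) :
    volume (ellipseErosion a b r) = ENNReal.ofReal (∫ t in alphaAng a b r..(π - alphaAng a b r),
      2 * parallelY a b r t * ((ellipseCurvRadius a b t - r) * Real.sin t)) := by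
  have ha := hb.trans hba
  have hα' := alphaAng_lt_pi_div_two a b r
  have hcont : Continuous fun t =>
      2 * parallelY a b r t * ((ellipseCurvRadius a b t - r) * Real.sin t) :=
    (continuous_const.mul (continuous_parallelY ha hb r)).mul
      (((continuous_ellipseCurvRadius ha hb).sub continuous_const).mul Real.continuous_sin)
  have hderiv_nonneg : ∀ t ∈ Icc (alphaAng a b r) (π - alphaAng a b r),
      0 ≤ (ellipseCurvRadius a b t - r) * Real.sin t := fun t ht =>
    mul_nonneg (sub_pos.2 (lt_ellipseCurvRadius hb hba hr1 hr2 ht)).le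
      (sin_pos_of_mem_arc hb hba hr1 hr2 ht).le
  have hsupp : Function.support
      (fun x => (volume : Measure ℝ) (Prod.mk x ⁻¹' ellipseErosion a b r)) ⊆
      parallelX a b r '' Icc (alphaAng a b r) (π - alphaAng a b r) := by
    intro x hx
    obtain ⟨y, hy⟩ := nonempty_of_measure_ne_zero hx
    exact fst_mem_image_of_mem_ellipseErosion hb hba hr1 hr2 hy
  rw [Measure.volume_eq_prod, Measure.prod_apply (isClosed_ellipseErosion a b r).measurableSet,
    ← setLIntegral_eq_of_support_subset hsupp,
    lintegral_image_eq_lintegral_abs_deriv_mul measurableSet_Icc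
      (fun t _ => (hasDerivAt_parallelX ha hb r t).hasDerivWithinAt)
      (injOn_parallelX hb hba hr1 hr2),
    intervalIntegral.integral_of_le (by linarith), ← integral_Icc_eq_integral_Ioc,
    ofReal_integral_eq_lintegral_ofReal (hcont.integrableOn_Icc)]
  · refine setLIntegral_congr_fun measurableSet_Icc fun t ht => ?_
    rw [slice_ellipseErosion hb hba hr1 hr2 ht, Real.volume_Icc, abs_neg,
      abs_of_nonneg (hderiv_nonneg t ht), ← ENNReal.ofReal_mul (hderiv_nonneg t ht)]
    congr 1
    ring
  · refine (ae_restrict_iff' measurableSet_Icc).2 (Filter.Eventually.of_forall fun t ht => ?_)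
    exact mul_nonneg (mul_nonneg two_pos.le (parallelY_nonneg hb hba hr1 hr2 ht))
      (hderiv_nonneg t ht)

end Angle

section Integral

variable {a b r : ℝ}

lemma sqrt_one_sub_ecc_sq (ha : 0 < a) (hb : 0 < b) (hba : b ≤ a) (t : ℝ) :
    Real.sqrt (1 - ecc a b^2 * Real.sin t^2) = ellipseSupport a b t / a := by
  have h : 0 ≤ a^2 - b^2 := by nlinarith
  have e := Real.sin_sq_add_cos_sq t
  have hp := ellipseSupport_pos ha hb t
  rw [Real.sqrt_eq_iff_mul_self_eq_of_pos (by positivity), ← sq, div_pow, ellipseSupport_sq, ecc,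
    div_pow, Real.sq_sqrt h]
  field_simp
  linear_combination a^2 * e

lemma mul_Einc_ecc (ha : 0 < a) (hb : 0 < b) (hba : b ≤ a) (t : ℝ) :
    a * Einc (ecc a b) t = ∫ θ in (0:ℝ)..t, ellipseSupport a b θ := by
  simp only [Einc, sqrt_one_sub_ecc_sq ha hb hba]
  rw [intervalIntegral.integral_div]
  field_simp

lemma Ffun_eq (ha : 0 < a) (hb : 0 < b) (hba : b ≤ a) (r t : ℝ) :
    Ffun a b r t = 2 * a * b * Real.arctan ((b / a) * Real.tan t) +
      (2 * r^2 * t - 4 * r * (∫ θ in (0:ℝ)..t, ellipseSupport a b θ)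
        + 2 * r * ((a^2 - b^2) * (Real.sin t * Real.cos t) / ellipseSupport a b t)) := by
  have h : 0 ≤ a^2 - b^2 := by nlinarith
  have hp := ellipseSupport_pos ha hb t
  rw [Ffun, sqrt_one_sub_ecc_sq ha hb hba, ← mul_Einc_ecc ha hb hba, Real.sin_two_mul]
  have : ecc a b^2 = (a^2 - b^2) / a^2 := by rw [ecc, div_pow, Real.sq_sqrt h]
  rw [this]
  field_simp
  ring

lemma hasDerivAt_arctan_mul_tan (ha : 0 < a) (hb : 0 < b) {t : ℝ} (ht : Real.cos t ≠ 0) :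
    HasDerivAt (fun t => Real.arctan ((b / a) * Real.tan t))
      (a * b / ellipseSupport a b t^2) t := by
  have h := ((Real.hasDerivAt_tan ht).const_mul (b / a)).arctan
  have hp := ellipseSupport_pos ha hb t
  have hs := ellipseSupport_sq a b t
  refine h.congr_deriv ?_
  rw [Real.tan_eq_sin_div_cos]
  have e : 1 + (b / a * (Real.sin t / Real.cos t))^2
      = ellipseSupport a b t^2 / (a^2 * Real.cos t^2) := by
    rw [hs]; field_simp
  rw [e]
  field_simp

lemma hasDerivAt_sin_mul_cos_div_ellipseSupport (ha : 0 < a) (hb : 0 < b) (t : ℝ) :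
    HasDerivAt (fun t => (a^2 - b^2) * (Real.sin t * Real.cos t) / ellipseSupport a b t)
      (ellipseSupport a b t - ellipseCurvRadius a b t) t := by
  have hp := ellipseSupport_pos ha hb t
  have hs := ellipseSupport_sq a b t
  have hc := Real.sin_sq_add_cos_sq t
  have h := (((Real.hasDerivAt_sin t).mul (Real.hasDerivAt_cos t)).const_mul (a^2 - b^2)).div
    (hasDerivAt_ellipseSupport ha hb t) hp.ne'
  refine h.congr_deriv ?_
  simp only [ellipseCurvRadius, Pi.mul_apply]
  generalize ellipseSupport a b t = k at *
  field_simp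
  have e1 : Real.sin t ^ 2 = 1 - Real.cos t ^ 2 := by linarith
  rw [e1] at hs
  have e4 : k^4 = (k^2)^2 := by ring
  simp only [e1, e4, hs]
  ring_nf

/-- The part of `Ffun a b r t - 2 * parallelX a b r t * parallelY a b r t` that is differentiable
everywhere. -/
lemma hasDerivAt_smooth_part (ha : 0 < a) (hb : 0 < b) (r t : ℝ) :
    HasDerivAt (fun t => 2 * r^2 * t - 4 * r * (∫ θ in (0:ℝ)..t, ellipseSupport a b θ)
        + 2 * r * ((a^2 - b^2) * (Real.sin t * Real.cos t) / ellipseSupport a b t)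
        - 2 * (parallelX a b r t * parallelY a b r t))
      (4 * parallelY a b r t * ((ellipseCurvRadius a b t - r) * Real.sin t)
        - 2 * a * b * (a * b / ellipseSupport a b t^2)) t := by
  have hcont := continuous_ellipseSupport a b
  have hp := ellipseSupport_pos ha hb t
  have h1 := intervalIntegral.integral_hasDerivAt_right (hcont.intervalIntegrable 0 t)
    (hcont.stronglyMeasurableAtFilter _ _) hcont.continuousAt
  have h := ((((hasDerivAt_id t).const_mul (2 * r^2)).sub (h1.const_mul (4 * r))).add
    ((hasDerivAt_sin_mul_cos_div_ellipseSupport ha hb t).const_mul (2 * r))).sub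
    (((hasDerivAt_parallelX ha hb r t).mul (hasDerivAt_parallelY ha hb r t)).const_mul 2)
  refine h.congr_deriv ?_
  have h0 := parallelX_mul_cos_add_parallelY_mul_sin ha hb r t
  have hρ : 2 * a * b * (a * b / ellipseSupport a b t^2)
      = 2 * (ellipseSupport a b t * ellipseCurvRadius a b t) := by
    rw [ellipseCurvRadius]; field_simp
  rw [hρ]
  linear_combination (-2 * (ellipseCurvRadius a b t - r)) * h0

lemma integral_half_arc (hb : 0 < b) (hba : b < a) {φ : ℝ} (hφ : φ ∈ Ioo 0 (π / 2)) (r : ℝ) :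
    ∫ t in φ..(π / 2), 4 * parallelY a b r t * ((ellipseCurvRadius a b t - r) * Real.sin t)
      = Astar a b r - Ffun a b r φ + 2 * (parallelX a b r φ * parallelY a b r φ) := by
  have ha := hb.trans hba
  have hcont : Continuous fun t =>
      4 * parallelY a b r t * ((ellipseCurvRadius a b t - r) * Real.sin t) :=
    (continuous_const.mul (continuous_parallelY ha hb r)).mul
      (((continuous_ellipseCurvRadius ha hb).sub continuous_const).mul Real.continuous_sin)
  have hcos : ∀ t ∈ Ico φ (π / 2), Real.cos t ≠ 0 := fun t ht =>
    (Real.cos_pos_of_mem_Ioo ⟨by linarith [hφ.1, ht.1, Real.pi_pos], ht.2⟩).ne'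
  have hd : ∀ t ∈ Ico φ (π / 2), HasDerivAt (fun t =>
      2 * a * b * Real.arctan ((b / a) * Real.tan t) +
      (2 * r^2 * t - 4 * r * (∫ θ in (0:ℝ)..t, ellipseSupport a b θ)
        + 2 * r * ((a^2 - b^2) * (Real.sin t * Real.cos t) / ellipseSupport a b t)
        - 2 * (parallelX a b r t * parallelY a b r t)))
      (4 * parallelY a b r t * ((ellipseCurvRadius a b t - r) * Real.sin t)) t := fun t ht => by
    refine (((hasDerivAt_arctan_mul_tan ha hb (hcos t ht)).const_mul (2 * a * b)).add
      (hasDerivAt_smooth_part ha hb r t)).congr_deriv ?_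
    ring
  have htan : Filter.Tendsto (fun t => Real.arctan ((b / a) * Real.tan t))
      (nhdsWithin (π / 2) (Iio (π / 2))) (nhds (π / 2)) :=
    (Real.tendsto_arctan_atTop.mono_right nhdsWithin_le_nhds).comp
      (Real.tendsto_tan_pi_div_two.const_mul_atTop (div_pos hb ha))
  rw [intervalIntegral.integral_eq_sub_of_hasDerivAt_of_tendsto hφ.2
    (fun t ht => hd t (Ioo_subset_Ico_self ht)) (hcont.intervalIntegrable _ _)
    ((hd φ ⟨le_rfl, hφ.2⟩).continuousAt.tendsto.mono_left nhdsWithin_le_nhds)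
    ((htan.const_mul (2 * a * b)).add
      ((hasDerivAt_smooth_part ha hb r (π / 2)).continuousAt.tendsto.mono_left
        nhdsWithin_le_nhds)),
    Ffun_eq ha hb hba.le, Astar, Ecomp, mul_assoc (4 * r) a, mul_Einc_ecc ha hb hba.le]
  simp only [parallelX, Real.cos_pi_div_two]
  ring

lemma integral_arc_eq (hb : 0 < b) (hba : b < a) (φ r : ℝ) :
    ∫ t in φ..(π - φ), 2 * parallelY a b r t * ((ellipseCurvRadius a b t - r) * Real.sin t)
      = ∫ t in φ..(π / 2),
          4 * parallelY a b r t * ((ellipseCurvRadius a b t - r) * Real.sin t) := by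
  have ha := hb.trans hba
  set f := fun t => 2 * parallelY a b r t * ((ellipseCurvRadius a b t - r) * Real.sin t) with hf
  have hcont : Continuous f :=
    (continuous_const.mul (continuous_parallelY ha hb r)).mul
      (((continuous_ellipseCurvRadius ha hb).sub continuous_const).mul Real.continuous_sin)
  have hsymm : ∀ t, f (π - t) = f t := fun t => by
    simp [hf, parallelY_pi_sub, ellipseCurvRadius, ellipseSupport_pi_sub]
  have h := intervalIntegral.integral_comp_sub_left f (a := φ) (b := π / 2) π
  simp only [hsymm, sub_half] at h
  rw [← intervalIntegral.integral_add_adjacent_intervals (hcont.intervalIntegrable φ (π / 2))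
    (hcont.intervalIntegrable (π / 2) (π - φ)), ← h, ← two_mul,
    ← intervalIntegral.integral_const_mul]
  congr 1
  ext t
  rw [hf]
  ring

end Integral

/-- Case 2 of Lemma 1: for `b²/a < r < b`, the area of the set of centers `x` with
`closedBall x r ⊆ K(a,b)` is `A* − F(α)`. -/
theorem area_ball_subset_ellipse_case2 (a b r : ℝ) (hb : 0 < b) (hba : b < a)
    (hr1 : b^2 / a < r) (hr2 : r < b) :
    volume {x : E2 | closedBall x r ⊆ Kset a b} =
      ENNReal.ofReal (Astar a b r - Ffun a b r (alphaAng a b r)) := by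
  have hr : 0 < r := lt_of_le_of_lt (by have := hb.trans hba; positivity) hr1
  rw [volume_closedBall_subset_Kset hr, volume_ellipseErosion hb hba hr1 hr2,
    integral_arc_eq hb hba, integral_half_arc hb hba
      ⟨alphaAng_pos hb hba hr1 hr2, alphaAng_lt_pi_div_two a b r⟩,
    parallelY_alphaAng hb hba hr1 hr2, mul_zero, mul_zero, add_zero]
end
end
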